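/- There exists a constant c > 0 such that for all integers n ≥ 1, P(U(n)) ≥ c, where U(n) is the event that there exists a site y ∈ B(n/2) such that y and y+(1,0) are the unique pair of neighboring sites of highest vertical level on a lowest horizontal open crossing of B(n). -/

import Mathlib

/-!
Critical site percolation on the triangular lattice realized on `ℤ²`.
A configuration assigns to each site `true` (open) or `false` (closed),
and `P` is the product Bernoulli(1/2) measure, axiomatized by
`IsBernoulliHalf` below (finite cylinder events have product probability).
-/

open MeasureTheory
open scoped ENNReal

/-- Sites of the lattice: vertices of `ℤ²`. -/
abbrev Site : Type := ℤ × ℤ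

/-- A percolation configuration: `true` = open, `false` = closed. -/
abbrev Config : Type := Site → Bool

/-- Adjacency for the triangular lattice realized on `ℤ²`:
the neighbors of `(x,y)` are `(x±1,y)`, `(x,y±1)`, `(x+1,y-1)`, `(x-1,y+1)`. -/
def Adj (a b : Site) : Prop :=
  (b.1 - a.1, b.2 - a.2) ∈
    ({(1, 0), (-1, 0), (0, 1), (0, -1), (1, -1), (-1, 1)} : Set (ℤ × ℤ))

/-- A (nonempty, self-avoiding) lattice path: a list of distinct sites in which
consecutive sites are neighbors. -/
def IsPath (p : List Site) : Prop := p ≠ [] ∧ p.Nodup ∧ p.Chain' Adj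

/-- A path all of whose vertices lie in the set `S`. -/
def PathIn (S : Set Site) (p : List Site) : Prop := IsPath p ∧ ∀ v ∈ p, v ∈ S

/-- All sites of `p` are open in `ω`. -/
def IsOpenOn (ω : Config) (p : List Site) : Prop := ∀ v ∈ p, ω v = true

/-- All sites of `p` are closed in `ω`. -/
def IsClosedOn (ω : Config) (p : List Site) : Prop := ∀ v ∈ p, ω v = false

/-- The first vertex of `p` lies in `A`. -/
def FirstIn (A : Set Site) (p : List Site) : Prop := ∃ a ∈ A, p.head? = some a

/-- The last vertex of `p` lies in `A`. -/
def LastIn (A : Set Site) (p : List Site) : Prop := ∃ a ∈ A, p.getLast? = some a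

/-- `μ` is the product Bernoulli(1/2) measure on configurations: a probability
measure for which every finite cylinder event has the product probability. -/
def IsBernoulliHalf (μ : Measure Config) : Prop :=
  IsProbabilityMeasure μ ∧
    ∀ (S : Finset Site) (f : Site → Bool),
      μ {ω | ∀ v ∈ S, ω v = f v} = (1 / 2 : ℝ≥0∞) ^ S.card

/-- The lattice rectangle `[x₀,x₁] × [y₀,y₁]`. -/
def rect (x₀ x₁ y₀ y₁ : ℤ) : Set Site :=
  {v | x₀ ≤ v.1 ∧ v.1 ≤ x₁ ∧ y₀ ≤ v.2 ∧ v.2 ≤ y₁}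

/-- The left side of a rectangle. -/
def rectLeft (x₀ x₁ y₀ y₁ : ℤ) : Set Site := {v ∈ rect x₀ x₁ y₀ y₁ | v.1 = x₀}

/-- The right side of a rectangle. -/
def rectRight (x₀ x₁ y₀ y₁ : ℤ) : Set Site := {v ∈ rect x₀ x₁ y₀ y₁ | v.1 = x₁}

/-- The top side of a rectangle. -/
def rectTop (x₀ x₁ y₀ y₁ : ℤ) : Set Site := {v ∈ rect x₀ x₁ y₀ y₁ | v.2 = y₁}

/-- The bottom side of a rectangle. -/
def rectBot (x₀ x₁ y₀ y₁ : ℤ) : Set Site := {v ∈ rect x₀ x₁ y₀ y₁ | v.2 = y₀}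

/-- A horizontal open crossing of the rectangle `[x₀,x₁] × [y₀,y₁]`:
an open path in the rectangle from its left side to its right side. -/
def HorizCrossing (x₀ x₁ y₀ y₁ : ℤ) (ω : Config) (p : List Site) : Prop :=
  PathIn (rect x₀ x₁ y₀ y₁) p ∧ IsOpenOn ω p ∧
    FirstIn (rectLeft x₀ x₁ y₀ y₁) p ∧ LastIn (rectRight x₀ x₁ y₀ y₁) p

/-- The set of sites of the rectangle lying on or beneath the path `q`: sites
that are on `q` or cannot be joined to the top side of the rectangle by a
lattice path avoiding `q`. -/
def OnOrBelow (x₀ x₁ y₀ y₁ : ℤ) (q : List Site) : Set Site :=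
  {v ∈ rect x₀ x₁ y₀ y₁ | v ∈ q ∨
    ¬ ∃ r : List Site, PathIn (rect x₀ x₁ y₀ y₁ \ {w | w ∈ q}) r ∧
        r.head? = some v ∧ LastIn (rectTop x₀ x₁ y₀ y₁) r}

/-- `p` is the lowest horizontal open crossing of the rectangle: it is a
horizontal open crossing lying on or beneath every horizontal open crossing. -/
def IsLowestCrossing (x₀ x₁ y₀ y₁ : ℤ) (ω : Config) (p : List Site) : Prop :=
  HorizCrossing x₀ x₁ y₀ y₁ ω p ∧
    ∀ q, HorizCrossing x₀ x₁ y₀ y₁ ω q → ∀ v ∈ p, v ∈ OnOrBelow x₀ x₁ y₀ y₁ q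

/-- `y` and `y + (1,0)` are the unique pair of neighboring sites of highest
vertical level on the path `p`: both belong to `p`, and every vertex of `p` of
maximal `y`-coordinate is one of them. -/
def HighestPair (p : List Site) (y : Site) : Prop :=
  y ∈ p ∧ (y.1 + 1, y.2) ∈ p ∧
    ∀ v ∈ p, v.2 ≤ y.2 ∧ (v.2 = y.2 → v = y ∨ v = (y.1 + 1, y.2))

/-! ### Connections inside a set of sites -/

theorem adj_iff {a b : Site} : Adj a b ↔
    (b.1 = a.1 + 1 ∧ b.2 = a.2) ∨ (b.1 = a.1 - 1 ∧ b.2 = a.2) ∨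
    (b.1 = a.1 ∧ b.2 = a.2 + 1) ∨ (b.1 = a.1 ∧ b.2 = a.2 - 1) ∨
    (b.1 = a.1 + 1 ∧ b.2 = a.2 - 1) ∨ (b.1 = a.1 - 1 ∧ b.2 = a.2 + 1) := by
  simp only [Adj, Set.mem_insert_iff, Set.mem_singleton_iff, Prod.mk.injEq]
  omega

theorem Adj.symm {a b : Site} (h : Adj a b) : Adj b a := by
  rw [adj_iff] at *; omega

/-- `u` and `v` are joined by a lattice walk all of whose sites lie in `O`. -/
def Conn (O : Set Site) (u v : Site) : Prop :=
  u ∈ O ∧ Relation.ReflTransGen (fun a b => Adj a b ∧ b ∈ O) u v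

namespace Conn

variable {O O' : Set Site} {u v w : Site}

theorem refl (h : u ∈ O) : Conn O u u := ⟨h, .refl⟩

theorem left_mem (h : Conn O u v) : u ∈ O := h.1

theorem tail (h : Conn O u v) (ha : Adj v w) (hw : w ∈ O) : Conn O u w :=
  ⟨h.1, h.2.tail ⟨ha, hw⟩⟩

theorem head (hu : u ∈ O) (ha : Adj u v) (h : Conn O v w) : Conn O u w :=
  ⟨hu, .head ⟨ha, h.1⟩ h.2⟩

@[elab_as_elim]
theorem tail_induction {P : ∀ v, Conn O u v → Prop} (base : ∀ h : u ∈ O, P u (refl h))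
    (step : ∀ a b (h : Conn O u a) (hab : Adj a b) (hb : b ∈ O), P a h → P b (h.tail hab hb))
    {v : Site} (h : Conn O u v) : P v h := by
  obtain ⟨hu, h⟩ := h
  induction h with
  | refl => exact base hu
  | tail hab hbc ih => exact step _ _ ⟨hu, hab⟩ hbc.1 hbc.2 ih

theorem right_mem (h : Conn O u v) : v ∈ O := by
  induction h using tail_induction with
  | base h => exact h
  | step a b _ _ hb _ => exact hb

theorem trans (h : Conn O u v) (h' : Conn O v w) : Conn O u w := ⟨h.1, h.2.trans h'.2⟩

theorem symm (h : Conn O u v) : Conn O v u := by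
  induction h using tail_induction with
  | base h => exact refl h
  | step a b _ hab hb ih => exact head hb hab.symm ih

theorem mono (h : Conn O u v) (hO : O ⊆ O') : Conn O' u v :=
  by
  induction h using tail_induction with
  | base h => exact refl (hO h)
  | step a b _ hab hb ih => exact ih.tail hab (hO hb)

theorem map (f : Site → Site) (hf : ∀ a b, Adj a b → Adj (f a) (f b))
    (hO : ∀ a ∈ O, f a ∈ O') (h : Conn O u v) : Conn O' (f u) (f v) := by
  induction h using tail_induction with
  | base h => exact refl (hO _ h)
  | step a b _ hab hb ih => exact ih.tail (hf _ _ hab) (hO _ hb)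

theorem cluster (h : Conn O u v) : Conn {w | Conn O u w} u v := by
  induction h using tail_induction with
  | base h => exact refl (refl h)
  | step a b ha hab hb ih => exact ih.tail hab (ha.tail hab hb)

theorem cluster_subset : {w | Conn O u w} ⊆ O := fun _ h => right_mem h

/-- Stop a walk at its first visit to `B`, provided it cannot leave `Q` before. -/
theorem truncate {Q B : Set Site} (h : Conn O u v) (hu : u ∈ Q)
    (hQ : ∀ a ∈ Q, a ∉ B → ∀ b ∈ O, Adj a b → b ∈ Q) (hv : v ∈ Q → v ∈ B) :
    ∃ w ∈ B, Conn (O ∩ Q) u w := by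
  have key : (∃ w ∈ B, Conn (O ∩ Q) u w) ∨ (v ∈ Q ∧ Conn (O ∩ Q) u v) := by
    clear hv
    induction h using tail_induction with
    | base h => exact Or.inr ⟨hu, refl ⟨h, hu⟩⟩
    | step a b ha hab hb ih =>
      rcases ih with ih | ⟨haQ, hca⟩
      · exact Or.inl ih
      · by_cases haB : a ∈ B
        · exact Or.inl ⟨a, haB, hca⟩
        · have hbQ := hQ a haQ haB b hb hab
          exact Or.inr ⟨hbQ, hca.tail hab ⟨hb, hbQ⟩⟩
  exact key.elim id fun ⟨hvQ, hc⟩ => ⟨v, hv hvQ, hc⟩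

/-- The part of a walk after its last visit to `A`. -/
theorem last_exit {A : Set Site} (h : Conn O u v) (hu : u ∈ A) :
    ∃ s ∈ A, s ∈ O ∧ Conn ({s} ∪ (O \ A)) s v := by
  induction h using tail_induction with
  | base h => exact ⟨u, hu, h, refl (by simp)⟩
  | step a b ha hab hb ih =>
    by_cases hbA : b ∈ A
    · exact ⟨b, hbA, hb, refl (by simp)⟩
    · obtain ⟨s, hs, hsO, hc⟩ := ih
      exact ⟨s, hs, hsO, hc.tail hab (Or.inr ⟨hb, hbA⟩)⟩

end Conn

/-! ### Crossings in two directions meet -/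

theorem mem_rect {x₀ x₁ y₀ y₁ : ℤ} {v : Site} :
    v ∈ rect x₀ x₁ y₀ y₁ ↔ x₀ ≤ v.1 ∧ v.1 ≤ x₁ ∧ y₀ ≤ v.2 ∧ v.2 ≤ y₁ := Iff.rfl

theorem site_ne {a b : Site} : a ≠ b ↔ a.1 ≠ b.1 ∨ a.2 ≠ b.2 := by
  rw [Ne, Prod.ext_iff]; tauto

/-- Whether the step from `b` to `c` crosses the vertical ray going up just to the right
of `w`. -/
def crossRay (b c w : Site) : ZMod 2 :=
  if (b.1 = w.1 ∧ c.1 = w.1 + 1 ∧ w.2 < b.2) ∨ (c.1 = w.1 ∧ b.1 = w.1 + 1 ∧ w.2 < c.2)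
  then 1 else 0

/-- The indicator of lying strictly above `w` in the column of `w`. -/
def indAbove (w t : Site) : ZMod 2 := if t.1 = w.1 ∧ w.2 < t.2 then 1 else 0

/-- The indicator of lying in a column at or to the left of `w`. -/
def indLeft (w t : Site) : ZMod 2 := if t.1 ≤ w.1 then 1 else 0

theorem crossRay_up {a b w : Site} (hb : (w.1, w.2 + 1) ≠ a) (hb' : (w.1, w.2 + 1) ≠ b) :
    crossRay a b (w.1, w.2 + 1) = crossRay a b w := by
  rw [site_ne] at *
  dsimp only at *
  unfold crossRay
  congr 1
  dsimp only
  rw [eq_iff_iff]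
  omega

set_option maxHeartbeats 1000000 in
theorem crossRay_side {a b w w' : Site} (hab : Adj a b) (h1 : w'.1 = w.1 + 1)
    (h2 : w'.2 = w.2 ∨ w'.2 = w.2 - 1) (ha : w ≠ a) (hb : w ≠ b) (ha' : w' ≠ a) (hb' : w' ≠ b) :
    crossRay a b w + crossRay a b w' = indAbove w' a + indAbove w' b := by
  rw [site_ne] at *
  rw [adj_iff] at hab
  unfold crossRay indAbove
  rcases hab with ⟨e1, e2⟩ | ⟨e1, e2⟩ | ⟨e1, e2⟩ | ⟨e1, e2⟩ | ⟨e1, e2⟩ | ⟨e1, e2⟩ <;>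
    split_ifs <;> first | rfl | (exfalso; omega)

theorem crossRay_bot {a b w : Site} (hab : Adj a b) (ha : w ≠ a) (hb : w ≠ b)
    (ha' : w.2 ≤ a.2) (hb' : w.2 ≤ b.2) :
    crossRay a b w = indLeft w a + indLeft w b := by
  rw [site_ne] at *
  rw [adj_iff] at hab
  unfold crossRay indLeft
  split_ifs <;> first | rfl | (exfalso; omega)

theorem crossRay_top {a b w : Site} (ha' : a.2 ≤ w.2) (hb' : b.2 ≤ w.2) :
    crossRay a b w = 0 := by
  unfold crossRay
  rw [if_neg]
  omega

/-- The parity of the number of crossings of the rays pointing up by a walk. -/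
theorem Conn.exists_parity {A : Set Site} {u v : Site} (h : Conn A u v) :
    ∃ N : Site → ZMod 2,
      (∀ w : Site, (w.1, w.2 + 1) ∉ A → N (w.1, w.2 + 1) = N w) ∧
      (∀ w w' : Site, w ∉ A → w' ∉ A → w'.1 = w.1 + 1 → (w'.2 = w.2 ∨ w'.2 = w.2 - 1) →
        N w + N w' = indAbove w' u + indAbove w' v) ∧
      (∀ w ∉ A, (∀ t ∈ A, w.2 ≤ t.2) → N w = indLeft w u + indLeft w v) ∧
      ∀ w, (∀ t ∈ A, t.2 ≤ w.2) → N w = 0 := by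
  have ne {w a : Site} (hw : w ∉ A) (ha : a ∈ A) : w ≠ a := fun h => hw (h ▸ ha)
  have h2 (x : ZMod 2) : x + x = 0 := CharTwo.add_self_eq_zero x
  induction h using tail_induction with
  | base h =>
    exact ⟨0, by simp [h2]⟩
  | step a b hua hab hb ih =>
    obtain ⟨N, h1, hN2, h3, h4⟩ := ih
    have ha := hua.right_mem
    refine ⟨fun w => N w + crossRay a b w, ?_, ?_, ?_, ?_⟩
    · intro w hw
      dsimp only
      rw [h1 w fun h => hw h, crossRay_up (ne hw ha) (ne hw hb)]
    · intro w w' hw hw' e1 e2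
      have := crossRay_side hab e1 e2 (ne hw ha) (ne hw hb) (ne hw' ha) (ne hw' hb)
      linear_combination hN2 w w' hw hw' e1 e2 + this + h2 (indAbove w' a)
    · intro w hw hl
      have := crossRay_bot hab (ne hw ha) (ne hw hb) (hl a ha) (hl b hb)
      linear_combination h3 w hw hl + this + h2 (indLeft w a)
    · intro w hl
      dsimp only
      rw [h4 w hl, crossRay_top (hl a ha) (hl b hb), add_zero]

/-- A horizontal and a vertical crossing of a rectangle have a common site. -/
theorem cross_meet {x₀ x₁ y₀ y₁ : ℤ} {A B : Set Site} {u v w z : Site}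
    (hA : A ⊆ rect x₀ x₁ y₀ y₁) (hB : B ⊆ rect x₀ x₁ y₀ y₁)
    (huv : Conn A u v) (hu : u.1 = x₀) (hv : v.1 = x₁)
    (hwz : Conn B w z) (hw : w.2 = y₀) (hz : z.2 = y₁) : (A ∩ B).Nonempty := by
  by_contra hdis
  have hdis' : ∀ t ∈ B, t ∉ A := fun t ht ht' => hdis ⟨t, ht', ht⟩
  have hext : Conn (A ∪ {(x₁ + 1, v.2)}) u (x₁ + 1, v.2) := by
    refine (huv.mono Set.subset_union_left).tail ?_ (by simp)
    rw [adj_iff]; simp [hv]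
  have hvA := hA huv.right_mem
  obtain ⟨N, h1, h2, h3, h4⟩ := hext.exists_parity
  have hnot : ∀ t ∈ B, t ∉ A ∪ {(x₁ + 1, v.2)} := by
    rintro t ht (h | h)
    · exact hdis' t ht h
    · have := (hB ht).2.1
      rw [Set.mem_singleton_iff] at h
      rw [h] at this
      simp at this
  have hs : ∀ a ∈ B, ∀ b ∈ B, b.1 = a.1 + 1 → (b.2 = a.2 ∨ b.2 = a.2 - 1) → N a = N b := by
    intro a ha b hb e1 e2
    have := h2 a b (hnot a ha) (hnot b hb) e1 e2
    have ra := hB ha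
    have rb := hB hb
    rw [mem_rect] at ra rb
    unfold indAbove at this
    rw [if_neg (by omega), if_neg (by omega), add_zero] at this
    rw [eq_neg_of_add_eq_zero_left this, ZModModule.neg_eq_self]
  have hup : ∀ a ∈ B, ∀ b ∈ B, b.1 = a.1 → b.2 = a.2 + 1 → N a = N b := by
    intro a ha b hb e1 e2
    have : b = (a.1, a.2 + 1) := Prod.ext e1 e2
    rw [this, h1 a (this ▸ hnot b hb)]
  have hconst : N w = N z := by
    clear hz
    induction hwz using Conn.tail_induction with
    | base h => rfl
    | step a b hwa hab hb ih =>
      have ha := hwa.right_mem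
      rw [ih]
      rw [adj_iff] at hab
      rcases hab with ⟨e1, e2⟩ | ⟨e1, e2⟩ | ⟨e1, e2⟩ | ⟨e1, e2⟩ | ⟨e1, e2⟩ | ⟨e1, e2⟩
      · exact hs a ha b hb e1 (Or.inl e2)
      · exact (hs b hb a ha (by omega) (by omega)).symm
      · exact hup a ha b hb e1 e2
      · exact (hup b hb a ha (by omega) (by omega)).symm
      · exact hs a ha b hb e1 (Or.inr e2)
      · exact (hs b hb a ha (by omega) (by omega)).symm
  have hwB := hB hwz.left_mem
  have e1 : N w = 1 := by
    rw [h3 w (hnot w hwz.left_mem)]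
    · rw [mem_rect] at hwB
      unfold indLeft
      rw [if_pos (by omega), if_neg (by omega), add_zero]
    · rintro t (ht | ht)
      · exact hw ▸ (hA ht).2.2.1
      · rw [Set.mem_singleton_iff] at ht
        subst ht
        exact hw ▸ hvA.2.2.1
  have e0 : N z = 0 := by
    apply h4
    rintro t (ht | ht)
    · exact hz ▸ (hA ht).2.2.2
    · rw [Set.mem_singleton_iff] at ht
      subst ht
      exact hz ▸ hvA.2.2.2
  rw [e1, e0] at hconst
  exact one_ne_zero hconst

/-! ### Either an open horizontal or a closed vertical crossing exists -/

/-- The signed distance from `a` to `b` on the cycle `ℤ/4`, for labels `0, 1, 2, 3` that are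
not opposite. -/
def cycDist (a b : ℤ) : ℤ := if b - a = 3 then -1 else if b - a = -3 then 1 else b - a

theorem cycDist_add {p q r : ℤ} (hp : 0 ≤ p ∧ p ≤ 3) (hq : 0 ≤ q ∧ q ≤ 3) (hr : 0 ≤ r ∧ r ≤ 3)
    (hpq : q - p ≠ 2 ∧ q - p ≠ -2) (hqr : r - q ≠ 2 ∧ r - q ≠ -2) (hpr : r - p ≠ 2 ∧ r - p ≠ -2) :
    cycDist p q + cycDist q r = cycDist p r := by
  unfold cycDist
  split_ifs <;> omega

theorem cycDist_neg (p q : ℤ) : cycDist p q = -cycDist q p := by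
  unfold cycDist
  split_ifs <;> omega

theorem telescope_eq {n : ℕ} {g l : ℕ → ℤ} (h : ∀ k < n, g (k + 1) - g k = l (k + 1) - l k) :
    g n - g 0 = l n - l 0 := by
  induction n with
  | zero => simp
  | succ n ih =>
    have := ih fun k hk => h k (by omega)
    have := h n (by omega)
    omega

/-- A labelling of a triangulated grid by `ℤ/4` without opposite neighbors lifts to `ℤ`. -/
theorem exists_lift {a b : ℕ} {L : ℕ → ℕ → ℤ} (h0 : ∀ i j, 0 ≤ L i j ∧ L i j ≤ 3)
    (h1 : ∀ i j, i < a → j ≤ b → L (i + 1) j - L i j ≠ 2 ∧ L (i + 1) j - L i j ≠ -2)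
    (h2 : ∀ i j, i ≤ a → j < b → L i (j + 1) - L i j ≠ 2 ∧ L i (j + 1) - L i j ≠ -2)
    (h3 : ∀ i j, i < a → j < b → L (i + 1) j - L i (j + 1) ≠ 2 ∧ L (i + 1) j - L i (j + 1) ≠ -2) :
    ∃ f : ℕ → ℕ → ℤ, (∀ i j, f i (j + 1) - f i j = cycDist (L i j) (L i (j + 1))) ∧
      ∀ i j, i < a → j ≤ b → f (i + 1) j - f i j = cycDist (L i j) (L (i + 1) j) := by
  refine ⟨fun i j => ∑ k ∈ Finset.range i, cycDist (L k 0) (L (k + 1) 0) +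
    ∑ k ∈ Finset.range j, cycDist (L i k) (L i (k + 1)), ?_, ?_⟩
  · intro i j
    simp [Finset.sum_range_succ]
  · intro i j hi hj
    induction j with
    | zero => simp [Finset.sum_range_succ]
    | succ j ih =>
      have ih := ih (by omega)
      have key : cycDist (L (i + 1) j) (L (i + 1) (j + 1)) + cycDist (L i j) (L (i + 1) j) -
          cycDist (L i j) (L i (j + 1)) = cycDist (L i (j + 1)) (L (i + 1) (j + 1)) := by
        have a1 := h0 i j
        have a2 := h0 (i + 1) j
        have a3 := h0 i (j + 1)
        have a4 := h0 (i + 1) (j + 1)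
        have b1 := h1 i j hi (by omega)
        have b2 := h1 i (j + 1) hi (by omega)
        have b3 := h2 i j (by omega) (by omega)
        have b4 := h2 (i + 1) j (by omega) (by omega)
        have b5 := h3 i j (by omega) (by omega)
        have c1 := cycDist_add a1 a2 a3 b1 (by omega) b3
        have c2 := cycDist_add a3 a2 a4 b5 b4 b2
        have c3 := cycDist_neg (L (i + 1) j) (L i (j + 1))
        linarith
      dsimp only at ih ⊢
      rw [Finset.sum_range_succ _ j, Finset.sum_range_succ _ j]
      linarith

/-- There is no labelling of a grid by `ℤ/4` without opposite neighbors that avoids the labels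
`2, 3, 0, 1` on the left, bottom, right and top side, respectively. -/
theorem no_labelling {a b : ℕ} {L : ℕ → ℕ → ℤ} (h0 : ∀ i j, 0 ≤ L i j ∧ L i j ≤ 3)
    (h1 : ∀ i j, i < a → j ≤ b → L (i + 1) j - L i j ≠ 2 ∧ L (i + 1) j - L i j ≠ -2)
    (h2 : ∀ i j, i ≤ a → j < b → L i (j + 1) - L i j ≠ 2 ∧ L i (j + 1) - L i j ≠ -2)
    (h3 : ∀ i j, i < a → j < b → L (i + 1) j - L i (j + 1) ≠ 2 ∧ L (i + 1) j - L i (j + 1) ≠ -2)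
    (hl : ∀ j ≤ b, L 0 j ≠ 2) (hb : ∀ i ≤ a, L i 0 ≠ 3) (hr : ∀ j ≤ b, L a j ≠ 0)
    (ht : ∀ i ≤ a, L i b ≠ 1) : False := by
  obtain ⟨f, f1, f2⟩ := exists_lift h0 h1 h2 h3
  have left := telescope_eq (n := b) (g := fun j => f 0 j)
    (l := fun j => if L 0 j = 3 then -1 else L 0 j) fun k hk => by
      have := f1 0 k
      have := h0 0 k
      have := h0 0 (k + 1)
      have := h2 0 k (by omega) hk
      have := hl k (by omega)
      have := hl (k + 1) (by omega)
      unfold cycDist at *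
      split_ifs at * <;> omega
  have bot := telescope_eq (n := a) (g := fun i => f i 0) (l := fun i => L i 0) fun k hk => by
      have := f2 k 0 hk (by omega)
      have := h0 k 0
      have := h0 (k + 1) 0
      have := hb k (by omega)
      have := hb (k + 1) (by omega)
      unfold cycDist at *
      split_ifs at * <;> omega
  have right := telescope_eq (n := b) (g := fun j => f a j) (l := fun j => L a j) fun k hk => by
      have := f1 a k
      have := h0 a k
      have := h0 a (k + 1)
      have := hr k (by omega)
      have := hr (k + 1) (by omega)
      unfold cycDist at *
      split_ifs at * <;> omega
  have top := telescope_eq (n := a) (g := fun i => f i b)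
    (l := fun i => if L i b = 0 then 4 else L i b) fun k hk => by
      have := f2 k b hk (by omega)
      have := h0 k b
      have := h0 (k + 1) b
      have := h1 k b hk (by omega)
      have := ht k (by omega)
      have := ht (k + 1) (by omega)
      unfold cycDist at *
      split_ifs at * <;> omega
  have := h0 0 b
  have := h0 a b
  have := h0 0 0
  have := hl 0 (by omega)
  have := hl b (by omega)
  have := hb 0 (by omega)
  have := hr b (by omega)
  have := ht 0 (by omega)
  have := ht a (by omega)
  split_ifs at * <;> omega

open Classical in
/-- The Hex lemma: a rectangle has a horizontal crossing in `O` or a vertical crossing in the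
complement of `O`. -/
theorem hex {x₀ x₁ y₀ y₁ : ℤ} (hx : x₀ ≤ x₁) (hy : y₀ ≤ y₁) (O : Set Site) :
    (∃ u v : Site, u.1 = x₀ ∧ v.1 = x₁ ∧ Conn (O ∩ rect x₀ x₁ y₀ y₁) u v) ∨
      ∃ u v : Site, u.2 = y₀ ∧ v.2 = y₁ ∧ Conn (Oᶜ ∩ rect x₀ x₁ y₀ y₁) u v := by
  by_contra! hcon
  obtain ⟨hc1, hc2⟩ := hcon
  obtain ⟨a, rfl⟩ : ∃ a : ℕ, x₁ = x₀ + a := ⟨(x₁ - x₀).toNat, by omega⟩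
  obtain ⟨b, rfl⟩ : ∃ b : ℕ, y₁ = y₀ + b := ⟨(y₁ - y₀).toNat, by omega⟩
  set R := rect x₀ (x₀ + a) y₀ (y₀ + b) with hR
  let lab : Site → ℤ := fun v =>
    if v ∈ O then (if ∃ u : Site, u.1 = x₀ ∧ Conn (O ∩ R) u v then 0 else 2)
    else (if ∃ u : Site, u.2 = y₀ ∧ Conn (Oᶜ ∩ R) u v then 1 else 3)
  have hadj : ∀ u v : Site, u ∈ R → v ∈ R → Adj u v → lab u - lab v ≠ 2 := by
    intro u v hu hv huv
    by_cases hu' : u ∈ O <;> by_cases hv' : v ∈ O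
    · have : (∃ z : Site, z.1 = x₀ ∧ Conn (O ∩ R) z u) ↔ ∃ z : Site, z.1 = x₀ ∧ Conn (O ∩ R) z v :=
        ⟨fun ⟨z, h, h'⟩ => ⟨z, h, h'.tail huv ⟨hv', hv⟩⟩,
          fun ⟨z, h, h'⟩ => ⟨z, h, h'.tail huv.symm ⟨hu', hu⟩⟩⟩
      simp only [lab, hu', hv', this, if_true]
      omega
    · simp only [lab, hu', hv', if_true, if_false]
      split_ifs <;> omega
    · simp only [lab, hu', hv', if_true, if_false]
      split_ifs <;> omega
    · have : (∃ z : Site, z.2 = y₀ ∧ Conn (Oᶜ ∩ R) z u) ↔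
          ∃ z : Site, z.2 = y₀ ∧ Conn (Oᶜ ∩ R) z v :=
        ⟨fun ⟨z, h, h'⟩ => ⟨z, h, h'.tail huv ⟨hv', hv⟩⟩,
          fun ⟨z, h, h'⟩ => ⟨z, h, h'.tail huv.symm ⟨hu', hu⟩⟩⟩
      simp only [lab, hu', hv', this, if_false]
      omega
  have hmem : ∀ i j : ℕ, i ≤ a → j ≤ b → (x₀ + (i : ℤ), y₀ + (j : ℤ)) ∈ R := by
    intro i j hi hj
    rw [hR, mem_rect]
    dsimp only
    omega
  have hsym : ∀ u v : Site, u ∈ R → v ∈ R → Adj u v → lab u - lab v ≠ 2 ∧ lab u - lab v ≠ -2 := by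
    intro u v hu hv huv
    have := hadj u v hu hv huv
    have := hadj v u hv hu huv.symm
    omega
  refine no_labelling (a := a) (b := b) (L := fun i j => lab (x₀ + (i : ℤ), y₀ + (j : ℤ)))
    ?_ ?_ ?_ ?_ ?_ ?_ ?_ ?_
  · intro i j
    dsimp only [lab]
    split_ifs <;> omega
  · intro i j hi hj
    refine hsym _ _ (hmem _ _ (by omega) (by omega)) (hmem _ _ (by omega) (by omega)) ?_
    rw [adj_iff]; push_cast; omega
  · intro i j hi hj
    refine hsym _ _ (hmem _ _ (by omega) (by omega)) (hmem _ _ (by omega) (by omega)) ?_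
    rw [adj_iff]; push_cast; omega
  · intro i j hi hj
    refine hsym _ _ (hmem _ _ (by omega) (by omega)) (hmem _ _ (by omega) (by omega)) ?_
    rw [adj_iff]; push_cast; omega
  · intro j hj h
    dsimp only [lab] at h
    split_ifs at h <;> first | omega | skip
    next g1 g2 => exact g2 ⟨_, by simp, Conn.refl ⟨g1, hmem 0 j (by omega) hj⟩⟩
  · intro j hj h
    dsimp only [lab] at h
    split_ifs at h <;> first | omega | skip
    next g1 g2 => exact g2 ⟨_, by simp, Conn.refl ⟨g1, hmem j 0 hj (by omega)⟩⟩
  · intro j hj h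
    dsimp only [lab] at h
    split_ifs at h <;> first | omega | skip
    next g1 g2 =>
      obtain ⟨u, hu, huv⟩ := g2
      exact hc1 u _ hu rfl huv
  · intro j hj h
    dsimp only [lab] at h
    split_ifs at h <;> first | omega | skip
    next g1 g2 =>
      obtain ⟨u, hu, huv⟩ := g2
      exact hc2 u _ hu rfl huv

/-! ### Paths as lists -/

theorem Conn.exists_path {O : Set Site} {u v : Site} (h : Conn O u v) :
    ∃ p, PathIn O p ∧ p.head? = some u ∧ p.getLast? = some v := by
  replace h := h.symm
  induction h using Conn.tail_induction with
  | base h => exact ⟨[v], ⟨⟨by simp, by simp, List.isChain_singleton _⟩, by simpa using h⟩, by simp⟩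
  | step a b _ hab hb ih =>
    obtain ⟨p, ⟨⟨hne, hnd, hc⟩, hO⟩, h1, h2⟩ := ih
    by_cases hbp : b ∈ p
    · obtain ⟨s, t, rfl⟩ := List.append_of_mem hbp
      refine ⟨b :: t, ⟨⟨by simp, hnd.of_append_right, List.IsChain.right_of_append hc⟩,
        fun w hw => hO w (by simp_all)⟩, by simp, ?_⟩
      rw [← h2, List.getLast?_append_of_ne_nil _ (by simp)]
    · refine ⟨b :: p, ⟨⟨by simp, by simp [hbp, hnd], ?_⟩, ?_⟩, by simp, ?_⟩
      · refine List.isChain_cons.2 ⟨?_, hc⟩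
        intro y hy
        rw [h1, Option.mem_some_iff] at hy
        subst hy
        exact hab.symm
      · intro w hw
        rcases List.mem_cons.1 hw with rfl | hw
        · exact hb
        · exact hO w hw
      · rw [List.getLast?_cons, h2]; rfl

theorem conn_of_chain {p : List Site} {u x : Site} (hc : p.IsChain Adj) (hu : p.head? = some u)
    (hx : x ∈ p) : Conn {w | w ∈ p} u x := by
  induction p generalizing u with
  | nil => simp at hx
  | cons a p ih =>
    obtain rfl : a = u := by simpa using hu
    rcases List.mem_cons.1 hx with rfl | hx
    · exact .refl (by simp)
    · rw [List.isChain_cons] at hc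
      cases p with
      | nil => simp at hx
      | cons b q =>
        refine .head (by simp) (hc.1 b (by simp)) ((ih hc.2 rfl hx).mono ?_)
        intro w hw
        exact List.mem_cons_of_mem _ hw

theorem IsPath.conn {p : List Site} (hp : IsPath p) {u v : Site} (hu : u ∈ p) (hv : v ∈ p) :
    Conn {w | w ∈ p} u v := by
  obtain ⟨hne, -, hc⟩ := hp
  obtain ⟨a, ha⟩ : ∃ a, p.head? = some a := by
    cases p with
    | nil => exact absurd rfl hne
    | cons a q => exact ⟨a, rfl⟩
  exact (conn_of_chain hc ha hu).symm.trans (conn_of_chain hc ha hv)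

/-- A horizontal crossing in terms of `Conn`. -/
theorem HorizCrossing.conn {x₀ x₁ y₀ y₁ : ℤ} {ω : Config} {p : List Site}
    (h : HorizCrossing x₀ x₁ y₀ y₁ ω p) :
    ∃ u v : Site, u.1 = x₀ ∧ v.1 = x₁ ∧ Conn {w | w ∈ p} u v := by
  obtain ⟨⟨hp, hR⟩, ho, ⟨u, hu, hu'⟩, ⟨v, hv, hv'⟩⟩ := h
  exact ⟨u, v, hu.2, hv.2, hp.conn (List.mem_of_mem_head? hu') (List.mem_of_mem_getLast? hv')⟩

theorem exists_horizCrossing {x₀ x₁ y₀ y₁ : ℤ} {ω : Config} {O : Set Site} {u v : Site}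
    (hO : O ⊆ rect x₀ x₁ y₀ y₁) (hω : ∀ w ∈ O, ω w = true) (h : Conn O u v)
    (hu : u.1 = x₀) (hv : v.1 = x₁) :
    ∃ p, HorizCrossing x₀ x₁ y₀ y₁ ω p ∧ ∀ w ∈ p, w ∈ O := by
  obtain ⟨p, hp, h1, h2⟩ := h.exists_path
  exact ⟨p, ⟨⟨hp.1, fun w hw => hO (hp.2 w hw)⟩, fun w hw => hω w (hp.2 w hw),
    ⟨u, ⟨hO h.left_mem, hu⟩, h1⟩, ⟨v, ⟨hO h.right_mem, hv⟩, h2⟩⟩, hp.2⟩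

/-! ### Events depending on finitely many sites -/

/-- The event `E` depends only on the sites of `S`. -/
def Local (S : Finset Site) (E : Set Config) : Prop :=
  ∀ ω ω' : Config, (∀ v ∈ S, ω v = ω' v) → ω ∈ E → ω' ∈ E

/-- The event `E` is increasing. -/
def Incr (E : Set Config) : Prop :=
  ∀ ω ω' : Config, (∀ v, ω v = true → ω' v = true) → ω ∈ E → ω' ∈ E

theorem Local.mono {S T : Finset Site} {E : Set Config} (h : Local S E) (hST : S ⊆ T) :
    Local T E := fun ω ω' hω => h ω ω' fun v hv => hω v (hST hv)

theorem Local.inter {S : Finset Site} {E F : Set Config} (hE : Local S E) (hF : Local S F) :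
    Local S (E ∩ F) := fun ω ω' h hω => ⟨hE ω ω' h hω.1, hF ω ω' h hω.2⟩

theorem Local.compl {S : Finset Site} {E : Set Config} (hE : Local S E) : Local S Eᶜ :=
  fun ω ω' h hω hω' => hω (hE ω' ω (fun v hv => (h v hv).symm) hω')

theorem Incr.inter {E F : Set Config} (hE : Incr E) (hF : Incr F) : Incr (E ∩ F) :=
  fun ω ω' h hω => ⟨hE ω ω' h hω.1, hF ω ω' h hω.2⟩

/-- The configuration whose closed sites are those of `A`. -/
def cfg (A : Finset Site) : Config := fun v => decide (v ∉ A)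

/-- The cylinder of configurations agreeing with `f` on `S`. -/
def cyl (S : Finset Site) (f : Config) : Set Config := {ω | ∀ v ∈ S, ω v = f v}

theorem measurableSet_cyl (S : Finset Site) (f : Config) : MeasurableSet (cyl S f) := by
  have : cyl S f = ⋂ v ∈ S, (fun ω : Config => ω v) ⁻¹' {f v} := by
    ext ω; simp [cyl]
  rw [this]
  exact Finset.measurableSet_biInter _ fun v _ => measurable_pi_apply v (measurableSet_singleton _)

open Classical in
/-- The sets of closed sites in `S` that realize the event `E`. -/
noncomputable def fam (S : Finset Site) (E : Set Config) : Finset (Finset Site) :=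
  S.powerset.filter fun A => cfg A ∈ E

theorem mem_fam {S A : Finset Site} {E : Set Config} : A ∈ fam S E ↔ A ⊆ S ∧ cfg A ∈ E := by
  simp [fam]

theorem cfg_filter {S : Finset Site} (ω : Config) {v : Site} (hv : v ∈ S) :
    cfg (S.filter fun v => ω v = false) v = ω v := by
  cases h : ω v <;> simp [cfg, hv, h]

theorem Local.eq_biUnion {S : Finset Site} {E : Set Config} (hE : Local S E) :
    E = ⋃ A ∈ fam S E, cyl S (cfg A) := by
  ext ω
  simp only [Set.mem_iUnion, mem_fam, cyl, Set.mem_ofPred_eq, exists_prop]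
  constructor
  · intro h
    refine ⟨S.filter fun v => ω v = false, ⟨Finset.filter_subset _ _, ?_⟩, ?_⟩
    · exact hE ω _ (fun v hv => (cfg_filter ω hv).symm) h
    · exact fun v hv => (cfg_filter ω hv).symm
  · rintro ⟨A, ⟨-, hA⟩, h⟩
    exact hE _ _ (fun v hv => (h v hv).symm) hA

theorem Local.measurableSet {S : Finset Site} {E : Set Config} (hE : Local S E) :
    MeasurableSet E := by
  rw [hE.eq_biUnion]
  exact Finset.measurableSet_biUnion _ fun A _ => measurableSet_cyl _ _

theorem eq_of_cfg {S A B : Finset Site} (hA : A ⊆ S) (hB : B ⊆ S)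
    (h : ∀ v ∈ S, cfg A v = cfg B v) : A = B := by
  ext v
  by_cases hv : v ∈ S
  · have := h v hv
    simp only [cfg, decide_eq_decide] at this
    tauto
  · exact ⟨fun h => absurd (hA h) hv, fun h => absurd (hB h) hv⟩

section Measure

variable {μ : Measure Config}

/-- Probabilities of local events by counting. -/
theorem IsBernoulliHalf.measure_eq (hμ : IsBernoulliHalf μ) {S : Finset Site} {E : Set Config}
    (hE : Local S E) : μ E = (fam S E).card * (1 / 2 : ℝ≥0∞) ^ S.card := by
  conv_lhs => rw [hE.eq_biUnion]
  rw [measure_biUnion_finset]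
  · rw [Finset.sum_congr rfl fun A _ => show μ (cyl S (cfg A)) = _ from hμ.2 S (cfg A),
      Finset.sum_const, nsmul_eq_mul]
  · intro A hA B hB hAB
    refine Set.disjoint_left.2 fun ω h1 h2 => hAB ?_
    exact eq_of_cfg (mem_fam.1 hA).1 (mem_fam.1 hB).1 fun v hv => (h1 v hv).symm.trans (h2 v hv)
  · exact fun A _ => measurableSet_cyl _ _

theorem half_pow_mul_two_pow (n : ℕ) : (1 / 2 : ℝ≥0∞) ^ n * 2 ^ n = 1 := by
  rw [← mul_pow, one_div, ENNReal.inv_mul_cancel (by simp) (by simp), one_pow]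

/-- Harris' inequality. -/
theorem IsBernoulliHalf.harris (hμ : IsBernoulliHalf μ) {S : Finset Site} {E F : Set Config}
    (hE : Local S E) (hF : Local S F) (hE' : Incr E) (hF' : Incr F) :
    μ E * μ F ≤ μ (E ∩ F) := by
  have hlow {G : Set Config} (hG : Incr G) : IsLowerSet (fam S G : Set (Finset Site)) := by
    intro A B hBA hA
    rw [Finset.mem_coe, mem_fam] at *
    refine ⟨hBA.trans hA.1, hG _ _ (fun v hv => ?_) hA.2⟩
    simp only [cfg, decide_eq_true_eq] at *
    exact fun h => hv (hBA h)
  have key := (hlow hE').le_card_inter_finset' (hlow hF') (fun t ht => (mem_fam.1 ht).1)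
    (fun t ht => (mem_fam.1 ht).1)
  have hi : fam S E ∩ fam S F = fam S (E ∩ F) := by
    ext A; simp only [Finset.mem_inter, mem_fam, Set.mem_inter_iff]; tauto
  rw [hi] at key
  rw [hμ.measure_eq hE, hμ.measure_eq hF, hμ.measure_eq (hE.inter hF)]
  have key' : ((fam S E).card : ℝ≥0∞) * (fam S F).card ≤ 2 ^ S.card * (fam S (E ∩ F)).card := by
    exact_mod_cast key
  calc _ = (((fam S E).card : ℝ≥0∞) * (fam S F).card) *
        ((1 / 2 : ℝ≥0∞) ^ S.card * (1 / 2 : ℝ≥0∞) ^ S.card) := by ring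
    _ ≤ (2 ^ S.card * (fam S (E ∩ F)).card) *
        ((1 / 2 : ℝ≥0∞) ^ S.card * (1 / 2 : ℝ≥0∞) ^ S.card) := by gcongr
    _ = ((1 / 2 : ℝ≥0∞) ^ S.card * 2 ^ S.card) *
        ((fam S (E ∩ F)).card * (1 / 2 : ℝ≥0∞) ^ S.card) := by ring
    _ = _ := by rw [half_pow_mul_two_pow, one_mul]

/-- A map that is injective up to finite information bounds probabilities. -/
theorem IsBernoulliHalf.measure_le_of_injOn (hμ : IsBernoulliHalf μ) {S : Finset Site}
    {E E' : Set Config} (hE : Local S E) (hE' : Local S E') {τ : Type*} [Fintype τ]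
    (g : Config → Config) (t : Config → τ) (hg : ∀ ω ∈ E', g ω ∈ E)
    (hinj : ∀ ω ∈ E', ∀ ω' ∈ E', (∀ v ∉ S, ω v = ω' v) → (∀ v ∈ S, g ω v = g ω' v) → t ω = t ω' →
      ∀ v ∈ S, ω v = ω' v) : μ E' ≤ Fintype.card τ * μ E := by
  have key : (fam S E').card ≤ (fam S E ×ˢ (Finset.univ : Finset τ)).card := by
    refine Finset.card_le_card_of_injOn
      (fun A => (S.filter fun v => g (cfg A) v = false, t (cfg A))) ?_ ?_
    · intro A hA
      have hA := mem_fam.1 hA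
      simp only [Finset.coe_product, Finset.coe_univ, Set.mem_prod, Set.mem_univ, and_true,
        Finset.mem_coe, mem_fam]
      exact ⟨Finset.filter_subset _ _, hE _ _ (fun v hv => (cfg_filter _ hv).symm) (hg _ hA.2)⟩
    · intro A hA B hB hAB
      have hA := mem_fam.1 hA
      have hB := mem_fam.1 hB
      rw [Prod.mk.injEq] at hAB
      refine eq_of_cfg hA.1 hB.1 (hinj _ hA.2 _ hB.2 (fun v hv => ?_) (fun v hv => ?_) hAB.2)
      · have h1 : v ∉ A := fun h => hv (hA.1 h)
        have h2 : v ∉ B := fun h => hv (hB.1 h)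
        simp [cfg, h1, h2]
      · rw [← cfg_filter (g (cfg A)) hv, hAB.1, cfg_filter _ hv]
  rw [Finset.card_product, Finset.card_univ] at key
  have key' : ((fam S E').card : ℝ≥0∞) ≤ (fam S E).card * Fintype.card τ := by exact_mod_cast key
  rw [hμ.measure_eq hE, hμ.measure_eq hE']
  calc _ ≤ ((fam S E).card * Fintype.card τ : ℝ≥0∞) * (1 / 2 : ℝ≥0∞) ^ S.card := by gcongr
    _ = _ := by ring

/-- Relabel the sites by `σ` and flip those where `b` holds. -/
def recode (σ : Site ≃ Site) (b : Site → Bool) (ω : Config) : Config :=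
  fun v => xor (ω (σ v)) (b v)

theorem measurable_recode (σ : Site ≃ Site) (b : Site → Bool) : Measurable (recode σ b) :=
  measurable_pi_lambda _ fun v => (Measurable.of_discrete (f := fun x => xor x (b v))).comp
    (measurable_pi_apply (σ v))

theorem IsBernoulliHalf.map_recode (hμ : IsBernoulliHalf μ) (σ : Site ≃ Site) (b : Site → Bool) :
    IsBernoulliHalf (μ.map (recode σ b)) := by
  have := hμ.1
  refine ⟨Measure.isProbabilityMeasure_map (measurable_recode σ b).aemeasurable, fun S f => ?_⟩
  refine (Measure.map_apply (measurable_recode σ b) (measurableSet_cyl S f)).trans ?_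
  have : recode σ b ⁻¹' cyl S f =
      {ω | ∀ v ∈ S.map σ.toEmbedding, ω v = xor (f (σ.symm v)) (b (σ.symm v))} := by
    ext ω
    simp only [cyl, Set.mem_preimage, Set.mem_ofPred_eq, Finset.forall_mem_map, recode,
      Equiv.coe_toEmbedding, Equiv.symm_apply_apply]
    refine forall₂_congr fun v _ => ?_
    cases ω (σ v) <;> cases b v <;> cases f v <;> simp
  rw [this, hμ.2, Finset.card_map]

theorem IsBernoulliHalf.measure_recode (hμ : IsBernoulliHalf μ) (σ : Site ≃ Site)
    (b : Site → Bool) {S : Finset Site} {E : Set Config} (hE : Local S E) :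
    μ {ω | recode σ b ω ∈ E} = μ E := by
  have h := Measure.map_apply (μ := μ) (measurable_recode σ b) hE.measurableSet
  rw [(hμ.map_recode σ b).measure_eq hE, ← hμ.measure_eq hE] at h
  exact h.symm

end Measure

/-! ### Connection events -/

/-- The open sites of a configuration. -/
def opn (ω : Config) : Set Site := {v | ω v = true}

/-- The closed sites of a configuration. -/
def cld (ω : Config) : Set Site := {v | ω v = false}

theorem mem_opn {ω : Config} {v : Site} : v ∈ opn ω ↔ ω v = true := Iff.rfl

theorem mem_cld {ω : Config} {v : Site} : v ∈ cld ω ↔ ω v = false := Iff.rfl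

theorem not_mem_opn {ω : Config} {v : Site} : v ∉ opn ω ↔ v ∈ cld ω := by
  rw [mem_opn, mem_cld, Bool.not_eq_true]

/-- `A` and `B` are joined by an open walk inside `D`. -/
def Link (D A B : Set Site) : Set Config :=
  {ω | ∃ u ∈ A, ∃ v ∈ B, Conn (D ∩ opn ω) u v}

theorem Link.incr {D A B : Set Site} : Incr (Link D A B) := by
  rintro ω ω' h ⟨u, hu, v, hv, huv⟩
  exact ⟨u, hu, v, hv, huv.mono fun w hw => ⟨hw.1, h w hw.2⟩⟩

theorem Link.isLocal {S : Finset Site} {D A B : Set Site} (hD : D ⊆ S) :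
    Local S (Link D A B) := by
  rintro ω ω' h ⟨u, hu, v, hv, huv⟩
  refine ⟨u, hu, v, hv, huv.mono fun w hw => ⟨hw.1, ?_⟩⟩
  rw [mem_opn, ← h w (hD hw.1)]
  exact hw.2

/-- The sites of a rectangle as a finite set. -/
noncomputable def boxF (x₀ x₁ y₀ y₁ : ℤ) : Finset Site := Finset.Icc x₀ x₁ ×ˢ Finset.Icc y₀ y₁

theorem coe_boxF (x₀ x₁ y₀ y₁ : ℤ) : (boxF x₀ x₁ y₀ y₁ : Set Site) = rect x₀ x₁ y₀ y₁ := by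
  ext v
  simp only [boxF, Finset.mem_coe, Finset.mem_product, Finset.mem_Icc, mem_rect]
  tauto

theorem rect_subset_boxF (x₀ x₁ y₀ y₁ : ℤ) : rect x₀ x₁ y₀ y₁ ⊆ boxF x₀ x₁ y₀ y₁ :=
  (coe_boxF _ _ _ _).superset

section Measure

variable {μ : Measure Config}

theorem IsBernoulliHalf.harris_link (hμ : IsBernoulliHalf μ) {S : Finset Site}
    {D A B D' A' B' : Set Site} (hD : D ⊆ S) (hD' : D' ⊆ S) :
    μ (Link D A B) * μ (Link D' A' B') ≤ μ (Link D A B ∩ Link D' A' B') :=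
  hμ.harris (Link.isLocal hD) (Link.isLocal hD') Link.incr Link.incr

theorem IsBernoulliHalf.link_le (hμ : IsBernoulliHalf μ) {S : Finset Site}
    {D A B D' A' B' : Set Site} (σ : Site ≃ Site) (hD : D ⊆ S)
    (hσ : ∀ u v, Adj u v → Adj (σ u) (σ v)) (h1 : ∀ v ∈ D, σ v ∈ D') (h2 : ∀ v ∈ A, σ v ∈ A')
    (h3 : ∀ v ∈ B, σ v ∈ B') : μ (Link D A B) ≤ μ (Link D' A' B') := by
  rw [← hμ.measure_recode σ (fun _ => false) (Link.isLocal (A := A) (B := B) hD)]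
  refine measure_mono ?_
  rintro ω ⟨u, hu, v, hv, huv⟩
  refine ⟨σ u, h2 u hu, σ v, h3 v hv, huv.map σ hσ fun w hw => ⟨h1 w hw.1, ?_⟩⟩
  simpa [mem_opn, recode] using hw.2

/-- The exchange of the two coordinates. -/
def swapSite : Site ≃ Site := Equiv.prodComm ℤ ℤ

/-- The translation by a vector. -/
def shiftSite (t : Site) : Site ≃ Site := Equiv.addRight t

theorem adj_swapSite {u v : Site} (h : Adj u v) : Adj (swapSite u) (swapSite v) := by
  rw [adj_iff] at *
  simp only [swapSite, Equiv.prodComm_apply, Prod.fst_swap, Prod.snd_swap]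
  omega

theorem adj_shiftSite (t : Site) {u v : Site} (h : Adj u v) :
    Adj (shiftSite t u) (shiftSite t v) := by
  rw [adj_iff] at *
  simp only [shiftSite, Equiv.coe_addRight, Prod.fst_add, Prod.snd_add]
  omega

/-- A horizontal open crossing of the rectangle exists. -/
def HC (x₀ x₁ y₀ y₁ : ℤ) : Set Config := Link (rect x₀ x₁ y₀ y₁) {v | v.1 = x₀} {v | v.1 = x₁}

/-- A vertical open crossing of the rectangle exists. -/
def VC (x₀ x₁ y₀ y₁ : ℤ) : Set Config := Link (rect x₀ x₁ y₀ y₁) {v | v.2 = y₀} {v | v.2 = y₁}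

theorem HC.isLocal (x₀ x₁ y₀ y₁ : ℤ) : Local (boxF x₀ x₁ y₀ y₁) (HC x₀ x₁ y₀ y₁) :=
  Link.isLocal (rect_subset_boxF _ _ _ _)

theorem VC.isLocal (x₀ x₁ y₀ y₁ : ℤ) : Local (boxF x₀ x₁ y₀ y₁) (VC x₀ x₁ y₀ y₁) :=
  Link.isLocal (rect_subset_boxF _ _ _ _)

theorem IsBernoulliHalf.vc_ge (hμ : IsBernoulliHalf μ) (x₀ x₁ y₀ y₁ : ℤ) :
    μ (HC y₀ y₁ x₀ x₁) ≤ μ (VC x₀ x₁ y₀ y₁) := by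
  refine hμ.link_le swapSite (rect_subset_boxF _ _ _ _) (fun _ _ => adj_swapSite) ?_ ?_ ?_
  · intro v hv
    rw [mem_rect] at *
    simp only [swapSite, Equiv.prodComm_apply, Prod.fst_swap, Prod.snd_swap]
    omega
  · exact fun v hv => hv
  · exact fun v hv => hv

theorem IsBernoulliHalf.hc_shift (hμ : IsBernoulliHalf μ) {x₀ x₁ y₀ y₁ M N : ℤ}
    (hx : x₁ - x₀ = M) (hy : y₁ - y₀ = N) : μ (HC 0 M 0 N) ≤ μ (HC x₀ x₁ y₀ y₁) := by
  refine hμ.link_le (shiftSite (x₀, y₀)) (rect_subset_boxF _ _ _ _)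
    (fun _ _ => adj_shiftSite _) ?_ ?_ ?_ <;>
  · intro v hv
    simp only [mem_rect, shiftSite, Equiv.coe_addRight, Prod.fst_add, Prod.snd_add,
      Set.mem_ofPred_eq] at *
    omega

/-- The square crossing probability is at least one half. -/
theorem IsBernoulliHalf.square (hμ : IsBernoulliHalf μ) {N : ℤ} (hN : 0 ≤ N) :
    1 ≤ 2 * μ (HC 0 N 0 N) := by
  have := hμ.1
  have hcov : (Set.univ : Set Config) ⊆
      HC 0 N 0 N ∪ {ω | recode swapSite (fun _ => true) ω ∈ HC 0 N 0 N} := by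
    intro ω _
    rcases hex hN hN (opn ω) with ⟨u, v, hu, hv, h⟩ | ⟨u, v, hu, hv, h⟩
    · exact Or.inl ⟨u, hu, v, hv, h.mono fun w hw => ⟨hw.2, hw.1⟩⟩
    · refine Or.inr ⟨swapSite u, hu, swapSite v, hv, h.map swapSite (fun _ _ => adj_swapSite) ?_⟩
      rintro w ⟨hw, hw'⟩
      rw [Set.mem_compl_iff, not_mem_opn, mem_cld] at hw
      rw [mem_rect] at hw'
      refine ⟨?_, ?_⟩
      · rw [mem_rect]
        simp only [swapSite, Equiv.prodComm_apply, Prod.fst_swap, Prod.snd_swap]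
        omega
      · simp [mem_opn, recode, swapSite, hw]
  calc (1 : ℝ≥0∞) = μ Set.univ := measure_univ.symm
    _ ≤ _ := measure_mono hcov
    _ ≤ μ (HC 0 N 0 N) + μ {ω | recode swapSite (fun _ => true) ω ∈ HC 0 N 0 N} :=
      measure_union_le _ _
    _ = 2 * μ (HC 0 N 0 N) := by
      rw [hμ.measure_recode _ _ (HC.isLocal _ _ _ _), two_mul]

/-! ### Straight walks -/

theorem conn_hline {O : Set Site} {x x' y : ℤ} (hx : x ≤ x')
    (h : ∀ t, x ≤ t → t ≤ x' → (t, y) ∈ O) : Conn O (x, y) (x', y) := by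
  induction x', hx using Int.leInduction with
  | base => exact .refl (h _ le_rfl le_rfl)
  | succ k hk ih =>
    refine (ih fun t h1 h2 => h t h1 (by omega)).tail ?_ (h _ (by omega) le_rfl)
    rw [adj_iff]; simp

theorem conn_vline {O : Set Site} {x y y' : ℤ} (hy : y ≤ y')
    (h : ∀ t, y ≤ t → t ≤ y' → (x, t) ∈ O) : Conn O (x, y) (x, y') := by
  induction y', hy using Int.leInduction with
  | base => exact .refl (h _ le_rfl le_rfl)
  | succ k hk ih =>
    refine (ih fun t h1 h2 => h t h1 (by omega)).tail ?_ (h _ (by omega) le_rfl)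
    rw [adj_iff]; simp

end Measure

/-! ### Reflecting the unexplored part of a trapezoid -/

theorem Conn.eq_or_exists {W : Set Site} {s e : Site} (h : Conn ({s} ∪ W) s e) :
    e = s ∨ ∃ r, Adj s r ∧ Conn W r e := by
  induction h using Conn.tail_induction with
  | base h => exact Or.inl rfl
  | step a b _ hab hb ih =>
    by_cases hbs : b = s
    · exact Or.inl hbs
    · have hbW : b ∈ W := hb.resolve_left hbs
      rcases ih with rfl | ⟨r, hr, hc⟩
      · exact Or.inr ⟨b, hab, .refl hbW⟩
      · exact Or.inr ⟨r, hr, hc.tail hab hbW⟩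

/-- The isosceles trapezoid of height `N` with base `[0, 2 * a]` on the horizontal axis. -/
def trap (a N : ℤ) : Set Site := {v | 0 ≤ v.1 ∧ v.1 + v.2 ≤ 2 * a ∧ 0 ≤ v.2 ∧ v.2 ≤ N}

/-- The left half of the trapezoid. -/
def halfTrap (a N : ℤ) : Set Site := {v | 0 ≤ v.1 ∧ 2 * v.1 + v.2 ≤ 2 * a ∧ 0 ≤ v.2 ∧ v.2 ≤ N}

/-- The reflection of the trapezoid along its axis. -/
def mirror (a : ℤ) : Site ≃ Site where
  toFun v := (2 * a - v.1 - v.2, v.2)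
  invFun v := (2 * a - v.1 - v.2, v.2)
  left_inv v := Prod.ext (by dsimp only; ring) rfl
  right_inv v := Prod.ext (by dsimp only; ring) rfl

theorem mirror_fst (a : ℤ) (v : Site) : (mirror a v).1 = 2 * a - v.1 - v.2 := rfl

theorem mirror_snd (a : ℤ) (v : Site) : (mirror a v).2 = v.2 := rfl

theorem mirror_mirror (a : ℤ) (v : Site) : mirror a (mirror a v) = v := (mirror a).left_inv v

theorem adj_mirror (a : ℤ) {u v : Site} (h : Adj u v) : Adj (mirror a u) (mirror a v) := by
  rw [adj_iff] at *
  simp only [mirror_fst, mirror_snd]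
  omega

theorem mem_trap {a N : ℤ} {v : Site} :
    v ∈ trap a N ↔ 0 ≤ v.1 ∧ v.1 + v.2 ≤ 2 * a ∧ 0 ≤ v.2 ∧ v.2 ≤ N := Iff.rfl

theorem mem_halfTrap {a N : ℤ} {v : Site} :
    v ∈ halfTrap a N ↔ 0 ≤ v.1 ∧ 2 * v.1 + v.2 ≤ 2 * a ∧ 0 ≤ v.2 ∧ v.2 ≤ N := Iff.rfl

theorem halfTrap_subset_trap {a N : ℤ} : halfTrap a N ⊆ trap a N := by
  intro v hv
  rw [mem_trap]
  rw [mem_halfTrap] at hv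
  omega

theorem trap_subset_rect {a N : ℤ} : trap a N ⊆ rect 0 (2 * a) 0 N := by
  intro v hv
  rw [mem_rect]
  rw [mem_trap] at hv
  omega

theorem trap_subset_boxF {a N : ℤ} : trap a N ⊆ boxF 0 (2 * a) 0 N :=
  trap_subset_rect.trans (rect_subset_boxF _ _ _ _)

/-- The closed sites of the half trapezoid connected to its top side. -/
def topCluster (a N : ℤ) (ω : Config) : Set Site :=
  {v | ∃ t : Site, t.2 = N ∧ Conn (halfTrap a N ∩ cld ω) t v}

/-- The sites revealed when exploring the closed clusters of the top side. -/
def seen (a N : ℤ) (ω : Config) : Set Site :=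
  {v | v ∈ halfTrap a N ∧ (v.2 = N ∨ v ∈ topCluster a N ω ∨ ∃ c ∈ topCluster a N ω, Adj c v)}

/-- The sites of the trapezoid that are unexplored together with their mirror images. -/
def unexplored (a N : ℤ) (ω : Config) : Set Site :=
  {v | v ∈ trap a N ∧ v ∉ seen a N ω ∧ mirror a v ∉ seen a N ω}

theorem topCluster_subset_halfTrap {a N : ℤ} {ω : Config} : topCluster a N ω ⊆ halfTrap a N :=
  fun _ ⟨_, _, h⟩ => h.right_mem.1

theorem topCluster_subset_cld {a N : ℤ} {ω : Config} : topCluster a N ω ⊆ cld ω :=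
  fun _ ⟨_, _, h⟩ => h.right_mem.2

theorem topCluster_subset_seen {a N : ℤ} {ω : Config} : topCluster a N ω ⊆ seen a N ω :=
  fun _ h => ⟨topCluster_subset_halfTrap h, Or.inr (Or.inl h)⟩

theorem mem_topCluster_of_top {a N : ℤ} {ω : Config} {v : Site} (h : v ∈ halfTrap a N)
    (h1 : v.2 = N) (h2 : v ∈ cld ω) : v ∈ topCluster a N ω := ⟨v, h1, .refl ⟨h, h2⟩⟩

theorem mem_topCluster_of_adj {a N : ℤ} {ω : Config} {c v : Site} (hc : c ∈ topCluster a N ω)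
    (h : v ∈ halfTrap a N) (h1 : Adj c v) (h2 : v ∈ cld ω) : v ∈ topCluster a N ω := by
  obtain ⟨t, ht, htc⟩ := hc
  exact ⟨t, ht, htc.tail h1 ⟨h, h2⟩⟩

theorem topCluster_conn {a N : ℤ} {ω : Config} {v : Site} (h : v ∈ topCluster a N ω) :
    ∃ t : Site, t.2 = N ∧ Conn (topCluster a N ω) t v := by
  obtain ⟨t, ht, htv⟩ := h
  exact ⟨t, ht, htv.cluster.mono fun w hw => ⟨t, ht, hw⟩⟩

theorem topCluster_congr {a N : ℤ} {ω ω' : Config} (h : ∀ v ∈ seen a N ω, ω v = ω' v) :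
    topCluster a N ω' = topCluster a N ω := by
  ext v
  constructor
  · rintro ⟨t, ht, htv⟩
    induction htv using Conn.tail_induction with
    | base h0 =>
      refine mem_topCluster_of_top h0.1 ht ?_
      rw [mem_cld, h t ⟨h0.1, Or.inl ht⟩]
      exact h0.2
    | step b c _ hbc hc ih =>
      refine mem_topCluster_of_adj ih hc.1 hbc ?_
      rw [mem_cld, h c ⟨hc.1, Or.inr (Or.inr ⟨b, ih, hbc⟩)⟩]
      exact hc.2
  · intro hv
    obtain ⟨t, ht, htv⟩ := topCluster_conn hv
    refine ⟨t, ht, htv.mono fun w hw => ⟨topCluster_subset_halfTrap hw, ?_⟩⟩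
    rw [mem_cld, ← h w (topCluster_subset_seen hw)]
    exact topCluster_subset_cld hw

theorem seen_congr {a N : ℤ} {ω ω' : Config} (h : ∀ v ∈ seen a N ω, ω v = ω' v) :
    seen a N ω' = seen a N ω := by
  unfold seen
  rw [topCluster_congr h]

open Classical in
/-- Replace the unexplored part of a configuration by its flipped mirror image. -/
noncomputable def turn (a N : ℤ) (ω : Config) : Config :=
  fun v => if v ∈ unexplored a N ω then !ω (mirror a v) else ω v

theorem turn_of_unexplored {a N : ℤ} {ω : Config} {v : Site} (h : v ∈ unexplored a N ω) :
    turn a N ω v = !ω (mirror a v) := if_pos h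

theorem turn_of_not_unexplored {a N : ℤ} {ω : Config} {v : Site} (h : v ∉ unexplored a N ω) :
    turn a N ω v = ω v := if_neg h

theorem turn_of_seen {a N : ℤ} {ω : Config} {v : Site} (h : v ∈ seen a N ω) :
    turn a N ω v = ω v := turn_of_not_unexplored fun h' => h'.2.1 h

theorem seen_turn {a N : ℤ} {ω : Config} : seen a N (turn a N ω) = seen a N ω :=
  seen_congr fun _ hv => (turn_of_seen hv).symm

theorem unexplored_turn {a N : ℤ} {ω : Config} : unexplored a N (turn a N ω) = unexplored a N ω := by
  unfold unexplored
  rw [seen_turn]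

theorem mirror_mem_unexplored {a N : ℤ} {ω : Config} {v : Site} (h : v ∈ unexplored a N ω) :
    mirror a v ∈ unexplored a N ω := by
  obtain ⟨h1, h2, h3⟩ := h
  refine ⟨?_, h3, by rwa [mirror_mirror]⟩
  rw [mem_trap] at *
  simp only [mirror_fst, mirror_snd]
  omega

theorem turn_turn {a N : ℤ} {ω : Config} : turn a N (turn a N ω) = ω := by
  ext v
  by_cases h : v ∈ unexplored a N ω
  · rw [turn_of_unexplored (by rwa [unexplored_turn]), turn_of_unexplored (mirror_mem_unexplored h),
      mirror_mirror, Bool.not_not]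
  · rw [turn_of_not_unexplored (by rwa [unexplored_turn]), turn_of_not_unexplored h]

/-- The left half of the trapezoid is crossed. -/
def HT (a N : ℤ) : Set Config :=
  Link (halfTrap a N) {v | v.1 = 0} {v | 2 * a - 1 ≤ 2 * v.1 + v.2}

/-- The left side of the trapezoid is connected to the right half of its base. -/
def NT (a N : ℤ) : Set Config := Link (trap a N) {v | v.1 = 0} {v | v.2 = 0 ∧ a ≤ v.1}

/-- If the left half of the trapezoid is crossed, so it is next to the explored clusters. -/
theorem exists_seen_crossing {a N : ℤ} (h0 : 0 ≤ N) (hN : N ≤ 2 * a) {ω : Config}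
    (h : ω ∈ HT a N) : ∃ u v : Site, u.1 = 0 ∧ 2 * a - 1 ≤ 2 * v.1 + v.2 ∧
      Conn (seen a N ω ∩ opn ω) u v := by
  have ha : 0 ≤ a := by omega
  rcases hex (x₀ := 0) (x₁ := 2 * a) (y₀ := 0) (y₁ := N) (by omega) h0
    ((seen a N ω ∩ opn ω) ∪ {v | 2 * a < 2 * v.1 + v.2}) with
    ⟨u, v, hu, hv, huv⟩ | ⟨b, t, hb, ht, hbt⟩
  · obtain ⟨w, hw, hc⟩ := huv.truncate (Q := {v : Site | 2 * v.1 + v.2 ≤ 2 * a})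
      (B := {v : Site | 2 * a - 1 ≤ 2 * v.1 + v.2})
      (by
        have := huv.left_mem.2
        rw [mem_rect] at this
        show 2 * u.1 + u.2 ≤ 2 * a
        omega)
      (by
        intro x hx hx' y _ hxy
        rw [adj_iff] at hxy
        simp only [Set.mem_ofPred_eq] at *
        omega)
      (by
        intro hv'
        have := huv.right_mem.2
        rw [mem_rect] at this
        simp only [Set.mem_ofPred_eq] at *
        omega)
    refine ⟨u, w, hu, hw, hc.mono ?_⟩
    rintro z ⟨⟨hz | hz, -⟩, hz'⟩
    · exact hz
    · simp only [Set.mem_ofPred_eq] at *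
      omega
  · exfalso
    have hR : ∀ v ∈ ((seen a N ω ∩ opn ω) ∪ {v | 2 * a < 2 * v.1 + v.2})ᶜ ∩ rect 0 (2 * a) 0 N,
        v ∈ halfTrap a N ∧ (v ∈ seen a N ω → v ∈ cld ω) := by
      rintro v ⟨hv, hv'⟩
      rw [Set.mem_compl_iff, Set.mem_union, not_or] at hv
      rw [mem_rect] at hv'
      obtain ⟨h1, h2⟩ := hv
      simp only [Set.mem_ofPred_eq] at h2
      refine ⟨?_, fun h => not_mem_opn.1 fun h' => h1 ⟨h, h'⟩⟩
      rw [mem_halfTrap]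
      omega
    have hbC : b ∈ topCluster a N ω := by
      replace hbt := hbt.symm
      clear hb
      induction hbt using Conn.tail_induction with
      | base h1 =>
        have := hR _ h1
        exact mem_topCluster_of_top this.1 ht (this.2 ⟨this.1, Or.inl ht⟩)
      | step c d _ hcd hd ih =>
        have := hR _ hd
        exact mem_topCluster_of_adj ih this.1 hcd (this.2 ⟨this.1, Or.inr (Or.inr ⟨c, ih, hcd⟩)⟩)
    obtain ⟨s, hs, hsb⟩ := hbC
    obtain ⟨u, hu, v, hv, huv⟩ := h
    have hu : u.1 = 0 := hu
    have hv : 2 * a - 1 ≤ 2 * v.1 + v.2 := hv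
    set A : Set Site := (halfTrap a N ∩ opn ω) ∪
      {v | v ∈ rect 0 (2 * a) 0 N ∧ 2 * a < 2 * v.1 + v.2} with hA
    have huA : ∃ z : Site, z.1 = 2 * a ∧ Conn A u z := by
      have hvR := huv.right_mem.1
      rw [mem_halfTrap] at hvR
      have huv' := huv.mono (O' := A) Set.subset_union_left
      by_cases hva : v.1 = 2 * a
      · exact ⟨v, hva, huv'⟩
      · have hline : Conn A (v.1 + 1, v.2) (2 * a, v.2) := by
          refine conn_hline (by omega) fun t h1 h2 => Or.inr ⟨?_, ?_⟩
          · rw [mem_rect]; dsimp only; omega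
          · dsimp only; omega
        refine ⟨_, rfl, (huv'.tail ?_ hline.left_mem).trans hline⟩
        rw [adj_iff]; simp
    obtain ⟨z, hz, huz⟩ := huA
    have hAR : A ⊆ rect 0 (2 * a) 0 N := by
      rintro x (hx | hx)
      · exact trap_subset_rect (halfTrap_subset_trap hx.1)
      · exact hx.1
    have hBR : halfTrap a N ∩ cld ω ⊆ rect 0 (2 * a) 0 N :=
      fun x hx => trap_subset_rect (halfTrap_subset_trap hx.1)
    obtain ⟨x, hx | hx, hx'⟩ := cross_meet hAR hBR huz hu hz hsb.symm hb hs
    · have h1 := mem_opn.1 hx.2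
      rw [mem_cld.1 hx'.2] at h1
      exact absurd h1 (by simp)
    · have := mem_halfTrap.1 hx'.1
      have := hx.2
      omega

/-- The row of sites below the right half of the base of the trapezoid. -/
def baseRow (a : ℤ) : Set Site := {v | v.2 = -1 ∧ a + 1 ≤ v.1}

theorem mem_baseRow {a : ℤ} {v : Site} : v ∈ baseRow a ↔ v.2 = -1 ∧ a + 1 ≤ v.1 := Iff.rfl

theorem seen_conn_extend {a N : ℤ} {ω : Config} {u w : Site}
    (hu : u.1 = 0) (hw : 2 * a - 1 ≤ 2 * w.1 + w.2) (h : Conn (seen a N ω ∩ opn ω) u w) :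
    ∃ z : Site, z.1 = 2 * a ∧
      Conn ({v | Conn (seen a N ω ∩ opn ω) u v} ∪ {v | Conn (seen a N ω ∩ opn ω) u (mirror a v)} ∪
        (rect 0 (2 * a) 0 N ∩ {v | 2 * a < v.1 + v.2})) u z := by
  have hwT := mem_halfTrap.1 h.right_mem.1.1
  have huT := mem_halfTrap.1 h.left_mem.1.1
  have h1 := h.cluster
  have h2 : Conn {v | Conn (seen a N ω ∩ opn ω) u (mirror a v)} (mirror a w) (mirror a u) := by
    refine h1.symm.map (mirror a) (fun _ _ => adj_mirror a) fun v hv => ?_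
    simp only [Set.mem_ofPred_eq, mirror_mirror] at *
    exact hv
  set A : Set Site := {v | Conn (seen a N ω ∩ opn ω) u v} ∪
    {v | Conn (seen a N ω ∩ opn ω) u (mirror a v)} ∪
    (rect 0 (2 * a) 0 N ∩ {v | 2 * a < v.1 + v.2})
  have h1' : Conn A u w := h1.mono fun v hv => Or.inl (Or.inl hv)
  have h2' : Conn A (mirror a w) (mirror a u) := h2.mono fun v hv => Or.inl (Or.inr hv)
  have h3 : Conn A u (mirror a u) := by
    by_cases hw' : mirror a w = w
    · exact h1'.trans (hw' ▸ h2')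
    · have hadj : Adj w (mirror a w) := by
        rw [Prod.ext_iff, mirror_fst, mirror_snd] at hw'
        rw [adj_iff, mirror_fst, mirror_snd]
        omega
      exact (h1'.tail hadj h2'.left_mem).trans h2'
  by_cases hu2 : u.2 = 0
  · exact ⟨_, by rw [mirror_fst]; omega, h3⟩
  · have hline : Conn A (2 * a - u.2 + 1, u.2) (2 * a, u.2) := by
      refine conn_hline (by omega) fun t h1 h2 => Or.inr ⟨?_, ?_⟩
      · rw [mem_rect]; dsimp only; omega
      · show 2 * a < t + u.2
        omega
    refine ⟨_, rfl, (h3.tail ?_ hline.left_mem).trans hline⟩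
    rw [adj_iff, mirror_fst, mirror_snd]
    dsimp only
    omega

/-- A connection from the explored part to the base yields a crossing of the trapezoid. -/
theorem mem_NT_of_conn {a N : ℤ} (h0 : 0 ≤ N) (hN : N ≤ 2 * a) {ω : Config} {u w s b : Site}
    (hu : u.1 = 0) (hw : 2 * a - 1 ≤ 2 * w.1 + w.2) (huw : Conn (seen a N ω ∩ opn ω) u w)
    (hs : s ∈ seen a N ω ∨ (s.1 ≤ -1 ∧ 0 ≤ s.2)) (hb : b ∈ baseRow a)
    (hsb : Conn ({s} ∪ ((unexplored a N ω ∩ opn ω) ∪ baseRow a)) s b) : ω ∈ NT a N := by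
  have ha : 0 ≤ a := by omega
  have hs0 : 0 ≤ s.2 := by
    rcases hs with hs | hs
    · exact (mem_halfTrap.1 hs.1).2.2.1
    · exact hs.2
  have hstep : ∀ x ∈ {v : Site | 0 ≤ v.2}, x ∉ {v : Site | v.2 = 0 ∧ a ≤ v.1} →
      ∀ y ∈ ({s} ∪ ((unexplored a N ω ∩ opn ω) ∪ baseRow a)), Adj x y → y ∈ {v : Site | 0 ≤ v.2} := by
    rintro x hx hx' y (rfl | hy | hy) hxy
    · exact hs0
    · exact (mem_trap.1 hy.1.1).2.2.1
    · rw [mem_baseRow] at hy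
      rw [adj_iff] at hxy
      simp only [Set.mem_ofPred_eq] at *
      omega
  obtain ⟨e, ⟨he, he'⟩, hse⟩ := hsb.truncate (Q := {v : Site | 0 ≤ v.2})
    (B := {v : Site | v.2 = 0 ∧ a ≤ v.1}) hs0 hstep (by
      intro hb'
      rw [mem_baseRow] at hb
      simp only [Set.mem_ofPred_eq] at *
      omega)
  replace hse : Conn ({s} ∪ (unexplored a N ω ∩ opn ω)) s e := by
    refine hse.mono ?_
    rintro v ⟨hv | hv | hv, hv'⟩
    · exact Or.inl hv
    · exact Or.inr hv
    · rw [mem_baseRow] at hv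
      simp only [Set.mem_ofPred_eq] at *
      omega
  have hW : unexplored a N ω ∩ opn ω ⊆ trap a N ∩ opn ω := fun v hv => ⟨hv.1.1, hv.2⟩
  rcases hs with hs | hs
  · have hsT := halfTrap_subset_trap hs.1
    obtain ⟨z, hz, huz⟩ := seen_conn_extend hu hw huw
    have htop : ∃ t : Site, t.2 = N ∧
        Conn (topCluster a N ω ∪ ({s} ∪ (unexplored a N ω ∩ opn ω))) t s := by
      have hsm : s ∈ topCluster a N ω ∪ ({s} ∪ (unexplored a N ω ∩ opn ω)) := by simp
      rcases hs.2 with h | h | ⟨c, hc, hcs⟩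
      · exact ⟨s, h, .refl hsm⟩
      · obtain ⟨t, ht, h⟩ := topCluster_conn h
        exact ⟨t, ht, h.mono Set.subset_union_left⟩
      · obtain ⟨t, ht, h⟩ := topCluster_conn hc
        exact ⟨t, ht, (h.mono Set.subset_union_left).tail hcs hsm⟩
    obtain ⟨t, ht, hts⟩ := htop
    have hte := hts.trans (hse.mono Set.subset_union_right)
    have hPT : ∀ v, Conn (seen a N ω ∩ opn ω) u v → v ∈ halfTrap a N := fun v h => h.right_mem.1.1
    have hTR : topCluster a N ω ∪ ({s} ∪ (unexplored a N ω ∩ opn ω)) ⊆ trap a N := by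
      rintro v (hv | rfl | hv)
      · exact halfTrap_subset_trap (topCluster_subset_halfTrap hv)
      · exact hsT
      · exact hv.1.1
    have hAR : {v | Conn (seen a N ω ∩ opn ω) u v} ∪
        {v | Conn (seen a N ω ∩ opn ω) u (mirror a v)} ∪
        (rect 0 (2 * a) 0 N ∩ {v | 2 * a < v.1 + v.2}) ⊆ rect 0 (2 * a) 0 N := by
      rintro v ((hv | hv) | hv)
      · exact trap_subset_rect (halfTrap_subset_trap (hPT _ hv))
      · have := mem_halfTrap.1 (hPT _ hv)
        rw [mirror_fst, mirror_snd] at this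
        rw [mem_rect]
        omega
      · exact hv.1
    have hus : Conn (seen a N ω ∩ opn ω) u s := by
      obtain ⟨x, hxA, hxT⟩ := cross_meet hAR (hTR.trans trap_subset_rect) huz hu hz hte.symm he ht
      rcases hxA with (hx | hx) | hx
      · rcases hxT with h | rfl | h
        · have h1 := mem_opn.1 hx.right_mem.2
          rw [mem_cld.1 (topCluster_subset_cld h)] at h1
          exact absurd h1 (by simp)
        · exact hx
        · exact absurd hx.right_mem.1 h.1.2.1
      · have hfix : x ∈ halfTrap a N → mirror a x = x := by
          intro h
          have h1 := mem_halfTrap.1 (hPT _ hx)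
          have h2 := mem_halfTrap.1 h
          rw [mirror_fst, mirror_snd] at h1
          rw [Prod.ext_iff, mirror_fst, mirror_snd]
          omega
        rcases hxT with h | rfl | h
        · have h1 := mem_opn.1 hx.right_mem.2
          rw [hfix (topCluster_subset_halfTrap h), mem_cld.1 (topCluster_subset_cld h)] at h1
          exact absurd h1 (by simp)
        · have := hfix hs.1
          rwa [Set.mem_ofPred_eq, this] at hx
        · exact absurd hx.right_mem.1 h.1.2.2
      · have h1 := mem_trap.1 (hTR hxT)
        have h2 : 2 * a < x.1 + x.2 := hx.2
        omega
    refine ⟨u, hu, e, ⟨he, he'⟩, ?_⟩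
    have hus' : Conn (trap a N ∩ opn ω) u s :=
      hus.mono fun v hv => ⟨halfTrap_subset_trap hv.1.1, hv.2⟩
    refine hus'.trans (hse.mono ?_)
    rintro v (rfl | hv)
    · exact ⟨hsT, hus.right_mem.2⟩
    · exact hW hv
  · rcases hse.eq_or_exists with rfl | ⟨r, hr, hre⟩
    · omega
    · refine ⟨r, ?_, e, ⟨he, he'⟩, hre.mono hW⟩
      have h1 := mem_trap.1 hre.left_mem.1.1
      rw [adj_iff] at hr
      show r.1 = 0
      omega

theorem mem_NT_or_turn_mem_NT {a N : ℤ} (h0 : 0 ≤ N) (hN : N ≤ 2 * a) {ω : Config}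
    (h : ω ∈ HT a N) : ω ∈ NT a N ∨ turn a N ω ∈ NT a N := by
  have ha : 0 ≤ a := by omega
  obtain ⟨u, w, hu, hw, huw⟩ := exists_seen_crossing h0 hN h
  have hseen : ∀ v ∈ seen a N ω, v ∈ trap a N := fun v hv => halfTrap_subset_trap hv.1
  set O : Set Site := {v | v.1 = -1 ∧ 0 ≤ v.2} ∪
    (seen a N ω ∪ ((unexplored a N ω ∩ opn ω) ∪ baseRow a)) with hO
  rcases hex (x₀ := -1) (x₁ := 2 * a + 1) (y₀ := -1) (y₁ := N) (by omega) (by omega) O with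
    ⟨l, r, hl, hr, hlr⟩ | ⟨b, t, hb, ht, hbt⟩
  · left
    obtain ⟨s, hsK, hsO, hsr⟩ := hlr.last_exit (A := {v | v.1 ≤ -1} ∪ seen a N ω)
      (Or.inl (by show l.1 ≤ -1; omega))
    have hrB : r ∈ baseRow a := by
      rcases hlr.right_mem.1 with h | h | h | h
      · have : r.1 = -1 := h.1
        omega
      · have := mem_trap.1 (hseen _ h)
        omega
      · have := mem_trap.1 h.1.1
        omega
      · exact h
    refine mem_NT_of_conn h0 hN hu hw huw (s := s) ?_ hrB (hsr.mono ?_)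
    · rcases hsK with h | h
      · have h : s.1 ≤ -1 := h
        refine Or.inr ⟨h, ?_⟩
        rcases hsO.1 with h' | h' | h' | h'
        · exact h'.2
        · exact (mem_trap.1 (hseen _ h')).2.2.1
        · exact (mem_trap.1 h'.1.1).2.2.1
        · have := mem_baseRow.1 h'
          omega
      · exact Or.inl h
    · rintro v (hv | ⟨⟨hv | hv | hv, -⟩, hv'⟩)
      · exact Or.inl hv
      · exact absurd (Or.inl (by have := hv.1; show v.1 ≤ -1; omega)) hv'
      · exact absurd (Or.inr hv) hv'
      · exact Or.inr hv
  · right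
    have hOc : ∀ v ∈ Oᶜ ∩ rect (-1) (2 * a + 1) (-1) N, (v.2 = -1 ∧ v.1 ≤ a) ∨
        (0 ≤ v.1 ∧ 0 ≤ v.2 ∧ v.2 ≤ N ∧ v ∉ seen a N ω ∧ (v ∈ unexplored a N ω → v ∈ cld ω)) := by
      rintro v ⟨hv, hv'⟩
      rw [mem_rect] at hv'
      simp only [hO, Set.mem_compl_iff, Set.mem_union, not_or, mem_baseRow] at hv
      obtain ⟨h1, h2, h3, h4⟩ := hv
      have h1 : ¬ (v.1 = -1 ∧ 0 ≤ v.2) := h1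
      by_cases hv2 : v.2 = -1
      · left; omega
      · right
        exact ⟨by omega, by omega, by omega, h2, fun h => not_mem_opn.1 fun h' => h3 ⟨h, h'⟩⟩
    have htK : t ∈ {v : Site | 2 * a + 1 ≤ v.1 + v.2} ∪ {v | mirror a v ∈ seen a N ω} := by
      by_cases h : 2 * a + 1 ≤ t.1 + t.2
      · exact Or.inl h
      · right
        have h1 := hOc t hbt.right_mem
        have h2 : t ∉ seen a N ω := by
          rcases h1 with h1 | h1
          · omega
          · exact h1.2.2.2.1
        have h3 : ¬ 2 * t.1 + t.2 ≤ 2 * a := by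
          intro h3
          refine h2 ⟨?_, Or.inl ht⟩
          rw [mem_halfTrap]
          omega
        refine ⟨?_, Or.inl ht⟩
        rw [mem_halfTrap, mirror_fst, mirror_snd]
        omega
    obtain ⟨s, hsK, hsO, hsb⟩ := hbt.symm.last_exit htK
    have hbB : mirror a b ∈ baseRow a := by
      rw [mem_baseRow, mirror_fst, mirror_snd]
      have := hOc b hbt.left_mem
      omega
    have huw' : Conn (seen a N (turn a N ω) ∩ opn (turn a N ω)) u w := by
      rw [seen_turn]
      refine huw.mono fun v hv => ⟨hv.1, ?_⟩
      rw [mem_opn, turn_of_seen hv.1]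
      exact hv.2
    refine mem_NT_of_conn h0 hN hu hw huw' (s := mirror a s) ?_ hbB
      (hsb.map (mirror a) (fun _ _ => adj_mirror a) ?_)
    · rw [seen_turn, mirror_fst, mirror_snd]
      rcases hsK with h | h
      · have h : 2 * a + 1 ≤ s.1 + s.2 := h
        have := hOc s hsO
        right
        omega
      · exact Or.inl h
    · rw [unexplored_turn]
      rintro v (rfl | ⟨hv, hvK⟩)
      · exact Or.inl rfl
      · simp only [Set.mem_union, not_or, Set.mem_ofPred_eq] at hvK
        right
        rcases hOc v hv with h | ⟨h1, h2, h3, h4, h5⟩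
        · right
          rw [mem_baseRow, mirror_fst, mirror_snd]
          omega
        · left
          have hvu : v ∈ unexplored a N ω := by
            refine ⟨?_, h4, hvK.2⟩
            rw [mem_trap]
            omega
          have hmu := mirror_mem_unexplored hvu
          refine ⟨hmu, ?_⟩
          rw [mem_opn, turn_of_unexplored hmu, mirror_mirror, mem_cld.1 (h5 hvu)]
          rfl

theorem NT.isLocal (a N : ℤ) : Local (boxF 0 (2 * a) 0 N) (NT a N) :=
  Link.isLocal trap_subset_boxF

theorem HT.isLocal (a N : ℤ) : Local (boxF 0 (2 * a) 0 N) (HT a N) :=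
  Link.isLocal (halfTrap_subset_trap.trans trap_subset_boxF)

theorem IsBernoulliHalf.measure_HT_le {μ : Measure Config} (hμ : IsBernoulliHalf μ) {a N : ℤ}
    (h0 : 0 ≤ N) (hN : N ≤ 2 * a) : μ (HT a N) ≤ 2 * μ (NT a N) := by
  have h1 : μ (HT a N ∩ (NT a N)ᶜ) ≤ μ (NT a N) := by
    have := hμ.measure_le_of_injOn (NT.isLocal a N) ((HT.isLocal a N).inter (NT.isLocal a N).compl)
      (turn a N) (fun _ => ()) (fun ω hω => (mem_NT_or_turn_mem_NT h0 hN hω.1).resolve_left hω.2)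
      (fun ω _ ω' _ hoff hon _ v _ => by
        have : turn a N ω = turn a N ω' := by
          ext v
          by_cases hv : v ∈ boxF 0 (2 * a) 0 N
          · exact hon v hv
          · rw [turn_of_not_unexplored fun h => hv (trap_subset_boxF h.1),
              turn_of_not_unexplored fun h => hv (trap_subset_boxF h.1), hoff v hv]
        rw [← turn_turn (a := a) (N := N) (ω := ω), this, turn_turn])
    simpa using this
  calc μ (HT a N) ≤ μ (NT a N ∪ HT a N ∩ (NT a N)ᶜ) := by
        refine measure_mono fun ω hω => ?_
        by_cases h : ω ∈ NT a N
        · exact Or.inl h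
        · exact Or.inr ⟨hω, h⟩
    _ ≤ μ (NT a N) + μ (HT a N ∩ (NT a N)ᶜ) := measure_union_le _ _
    _ ≤ 2 * μ (NT a N) := by rw [two_mul]; gcongr

/-- The two legs of the trapezoid are connected. -/
def FT (a N : ℤ) : Set Config := Link (trap a N) {v | v.1 = 0} {v | v.1 + v.2 = 2 * a}

/-- The right leg of the trapezoid is connected to the left half of its base. -/
def MT (a N : ℤ) : Set Config := Link (trap a N) {v | v.1 + v.2 = 2 * a} {v | v.2 = 0 ∧ v.1 ≤ a}

theorem NT_inter_MT_subset {a N : ℤ} : NT a N ∩ MT a N ⊆ FT a N := by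
  rintro ω ⟨⟨u, hu, v, ⟨hv, hv'⟩, huv⟩, ⟨r, hr, w, ⟨hw, hw'⟩, hrw⟩⟩
  have hu : u.1 = 0 := hu
  have hr : r.1 + r.2 = 2 * a := hr
  have hvT := mem_trap.1 huv.right_mem.1
  have hrT := mem_trap.1 hrw.left_mem.1
  have hwT := mem_trap.1 hrw.right_mem.1
  set A : Set Site := {z | Conn (trap a N ∩ opn ω) u z} ∪ {z | z.2 = -1 ∧ v.1 ≤ z.1 ∧ z.1 ≤ 2 * a}
  set B : Set Site := {z | Conn (trap a N ∩ opn ω) r z} ∪ ({(w.1, -1)} ∪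
    {z | z ∈ rect 0 (2 * a) 0 N ∧ 2 * a < z.1 + z.2})
  have hAR : A ⊆ rect 0 (2 * a) (-1) N := by
    rintro z (hz | ⟨h1, h2, h3⟩)
    · have := mem_trap.1 hz.right_mem.1
      rw [mem_rect]; omega
    · rw [mem_rect]; omega
  have hBR : B ⊆ rect 0 (2 * a) (-1) N := by
    rintro z (hz | rfl | ⟨hz, -⟩)
    · have := mem_trap.1 hz.right_mem.1
      rw [mem_rect]; omega
    · rw [mem_rect]; dsimp only; omega
    · rw [mem_rect] at *; omega
  have hA : Conn A u (2 * a, -1) := by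
    have hline : Conn A (v.1, -1) (2 * a, -1) :=
      conn_hline (by omega) fun t h1 h2 => Or.inr ⟨rfl, h1, h2⟩
    refine ((huv.cluster.mono Set.subset_union_left).tail ?_ hline.left_mem).trans hline
    rw [adj_iff]; dsimp only; omega
  have hBw : Conn B r (w.1, -1) := by
    refine (hrw.cluster.mono Set.subset_union_left).tail ?_ (Or.inr (Or.inl rfl))
    rw [adj_iff]; dsimp only; omega
  have hBt : Conn B r (r.1, N) := by
    by_cases hrN : r.2 = N
    · rw [← hrN]
      exact .refl hBw.left_mem
    · have hline : Conn B (r.1, r.2 + 1) (r.1, N) := by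
        refine conn_vline (by omega) fun t h1 h2 => Or.inr (Or.inr ⟨?_, ?_⟩)
        · rw [mem_rect]; dsimp only; omega
        · dsimp only; omega
      refine .head hBw.left_mem ?_ hline
      rw [adj_iff]; simp
  obtain ⟨z, hzA, hzB⟩ := cross_meet hAR hBR hA hu rfl (hBw.symm.trans hBt) rfl rfl
  rcases hzA with hz | ⟨h1, h2, h3⟩
  · have hzT := mem_trap.1 hz.right_mem.1
    rcases hzB with hz' | rfl | ⟨-, hz'⟩
    · exact ⟨u, hu, r, hr, hz.trans hz'.symm⟩
    · dsimp only at hzT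
      omega
    · omega
  · rcases hzB with hz' | rfl | ⟨hz', -⟩
    · have := mem_trap.1 hz'.right_mem.1
      omega
    · dsimp only at h2
      have hvw : v = w := Prod.ext (by omega) (by omega)
      exact ⟨u, hu, r, hr, huv.trans (hvw ▸ hrw.symm)⟩
    · have := mem_rect.1 hz'
      omega

/-- Crossing half of the trapezoid allows crossing the whole of it. -/
theorem IsBernoulliHalf.measure_HT_sq_le {μ : Measure Config} (hμ : IsBernoulliHalf μ) {a N : ℤ}
    (h0 : 0 ≤ N) (hN : N ≤ 2 * a) : μ (HT a N) ^ 2 ≤ 4 * μ (FT a N) := by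
  have h1 := hμ.measure_HT_le h0 hN
  have h2 : μ (NT a N) ≤ μ (MT a N) := by
    refine hμ.link_le (mirror a) trap_subset_boxF (fun _ _ => adj_mirror a) ?_ ?_ ?_ <;>
    · intro v hv
      simp only [mem_trap, mirror_fst, mirror_snd, Set.mem_ofPred_eq] at *
      omega
  calc μ (HT a N) ^ 2 ≤ (2 * μ (NT a N)) * (2 * μ (MT a N)) := by
        rw [sq]
        gcongr
        exact h1.trans (by gcongr)
    _ = 4 * (μ (NT a N) * μ (MT a N)) := by ring
    _ ≤ 4 * μ (FT a N) := by
        gcongr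
        exact (hμ.harris_link trap_subset_boxF trap_subset_boxF).trans
          (measure_mono NT_inter_MT_subset)

section Measure

variable {μ : Measure Config}

theorem half_pow_le_of_pow_le {j i : ℕ} {x : ℝ≥0∞} (h : (1 / 2 : ℝ≥0∞) ^ j ≤ 2 ^ i * x) :
    (1 / 2 : ℝ≥0∞) ^ (j + i) ≤ x := by
  calc (1 / 2 : ℝ≥0∞) ^ (j + i) = (1 / 2) ^ i * (1 / 2) ^ j := by rw [pow_add, mul_comm]
    _ ≤ (1 / 2) ^ i * (2 ^ i * x) := by gcongr
    _ = x := by rw [← mul_assoc, half_pow_mul_two_pow, one_mul]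

theorem IsBernoulliHalf.half_pow_le_FT (hμ : IsBernoulliHalf μ) {a N : ℤ} (h0 : 0 ≤ N)
    (hN : N ≤ 2 * a) {j : ℕ} (h : (1 / 2 : ℝ≥0∞) ^ j ≤ μ (HT a N)) :
    (1 / 2 : ℝ≥0∞) ^ (2 * j + 2) ≤ μ (FT a N) := by
  refine half_pow_le_of_pow_le ?_
  calc (1 / 2 : ℝ≥0∞) ^ (2 * j) = ((1 / 2) ^ j) ^ 2 := by rw [← pow_mul, mul_comm]
    _ ≤ μ (HT a N) ^ 2 := by gcongr
    _ ≤ 4 * μ (FT a N) := hμ.measure_HT_sq_le h0 hN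
    _ = 2 ^ 2 * μ (FT a N) := by norm_num

theorem FT_subset_HT {a K : ℤ} (h : K ≤ a) : FT a (2 * K) ⊆ HT (2 * a - K) (2 * K) := by
  rintro ω ⟨u, hu, v, hv, huv⟩
  have hu : u.1 = 0 := hu
  have hv : v.1 + v.2 = 2 * a := hv
  have huT := mem_trap.1 huv.left_mem.1
  have hvT := mem_trap.1 huv.right_mem.1
  have hstep : ∀ x ∈ {v : Site | 2 * v.1 + v.2 ≤ 2 * (2 * a - K)},
      x ∉ {v : Site | 2 * (2 * a - K) - 1 ≤ 2 * v.1 + v.2} → ∀ y ∈ trap a (2 * K) ∩ opn ω,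
      Adj x y → y ∈ {v : Site | 2 * v.1 + v.2 ≤ 2 * (2 * a - K)} := by
    intro x hx hx' y _ hxy
    rw [adj_iff] at hxy
    simp only [Set.mem_ofPred_eq] at *
    omega
  obtain ⟨w, hw, huw⟩ := huv.truncate (show 2 * u.1 + u.2 ≤ 2 * (2 * a - K) by omega) hstep
    (fun _ => show 2 * (2 * a - K) - 1 ≤ 2 * v.1 + v.2 by omega)
  refine ⟨u, hu, w, hw, huw.mono fun z hz => ⟨?_, hz.1.2⟩⟩
  have h1 := mem_trap.1 hz.1.1
  have h2 : 2 * z.1 + z.2 ≤ 2 * (2 * a - K) := hz.2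
  rw [mem_halfTrap]
  omega

theorem square_subset_HT {N : ℤ} : HC 0 N 0 N ⊆ HT N N := by
  rintro ω ⟨u, hu, v, hv, huv⟩
  have hu : u.1 = 0 := hu
  have hv : v.1 = N := hv
  have huT := mem_rect.1 huv.left_mem.1
  have hvT := mem_rect.1 huv.right_mem.1
  have hstep : ∀ x ∈ {v : Site | 2 * v.1 + v.2 ≤ 2 * N},
      x ∉ {v : Site | 2 * N - 1 ≤ 2 * v.1 + v.2} → ∀ y ∈ rect 0 N 0 N ∩ opn ω,
      Adj x y → y ∈ {v : Site | 2 * v.1 + v.2 ≤ 2 * N} := by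
    intro x hx hx' y _ hxy
    rw [adj_iff] at hxy
    simp only [Set.mem_ofPred_eq] at *
    omega
  obtain ⟨w, hw, huw⟩ := huv.truncate (show 2 * u.1 + u.2 ≤ 2 * N by omega) hstep
    (fun _ => show 2 * N - 1 ≤ 2 * v.1 + v.2 by omega)
  refine ⟨u, hu, w, hw, huw.mono fun z hz => ⟨?_, hz.1.2⟩⟩
  have h1 := mem_rect.1 hz.1.1
  have h2 : 2 * z.1 + z.2 ≤ 2 * N := hz.2
  rw [mem_halfTrap]
  omega

theorem FT_subset_HC {a N M : ℤ} (hM : 0 ≤ M) (h : M + N ≤ 2 * a) : FT a N ⊆ HC 0 M 0 N := by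
  rintro ω ⟨u, hu, v, hv, huv⟩
  have hu : u.1 = 0 := hu
  have hv : v.1 + v.2 = 2 * a := hv
  have hvT := mem_trap.1 huv.right_mem.1
  have hstep : ∀ x ∈ {v : Site | v.1 ≤ M}, x ∉ {v : Site | v.1 = M} →
      ∀ y ∈ trap a N ∩ opn ω, Adj x y → y ∈ {v : Site | v.1 ≤ M} := by
    intro x hx hx' y _ hxy
    rw [adj_iff] at hxy
    simp only [Set.mem_ofPred_eq] at *
    omega
  obtain ⟨w, hw, huw⟩ := huv.truncate (show u.1 ≤ M by omega) hstep
    (fun h' => show v.1 = M from le_antisymm h' (by omega))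
  refine ⟨u, hu, w, hw, huw.mono fun z hz => ⟨?_, hz.1.2⟩⟩
  have h1 := mem_trap.1 hz.1.1
  have h2 : z.1 ≤ M := hz.2
  rw [mem_rect]
  omega

/-- Russo-Seymour-Welsh: long rectangles are crossed with probability bounded below. -/
theorem IsBernoulliHalf.rsw (hμ : IsBernoulliHalf μ) {K M : ℤ} (hK : 0 ≤ K) (hM : 0 ≤ M)
    (h : M ≤ 32 * K) : (1 / 2 : ℝ≥0∞) ^ 94 ≤ μ (HC 0 M 0 (2 * K)) := by
  have hstep {a : ℤ} {j : ℕ} (ha : K ≤ a) (hj : (1 / 2 : ℝ≥0∞) ^ j ≤ μ (FT a (2 * K))) :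
      (1 / 2 : ℝ≥0∞) ^ (2 * j + 2) ≤ μ (FT (2 * a - K) (2 * K)) :=
    hμ.half_pow_le_FT (by omega) (by omega) (hj.trans (measure_mono (FT_subset_HT ha)))
  have h0 : (1 / 2 : ℝ≥0∞) ^ 1 ≤ μ (HT (2 * K) (2 * K)) := by
    refine (half_pow_le_of_pow_le (j := 0) (i := 1) ?_).trans (measure_mono square_subset_HT)
    simpa using hμ.square (N := 2 * K) (by omega)
  have h1 := hμ.half_pow_le_FT (by omega) (by omega) h0
  have h2 := hstep (by omega) h1
  have h3 := hstep (by omega) h2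
  have h4 := hstep (by omega) h3
  have h5 := hstep (by omega) h4
  exact h5.trans (measure_mono (FT_subset_HC hM (by omega)))

end Measure

/-! ### The lowest crossing -/

section Lowest

variable {x₀ x₁ y₀ y₁ : ℤ} {ω : Config}

/-- The closed sites connected to the bottom side of the rectangle. -/
def botCluster (x₀ x₁ y₀ y₁ : ℤ) (ω : Config) : Set Site :=
  {v | ∃ b : Site, b.2 = y₀ ∧ Conn (rect x₀ x₁ y₀ y₁ ∩ cld ω) b v}

/-- The open sites that are on the bottom side or next to a closed cluster of the bottom side. -/
def front (x₀ x₁ y₀ y₁ : ℤ) (ω : Config) : Set Site :=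
  {v | v ∈ rect x₀ x₁ y₀ y₁ ∧ v ∈ opn ω ∧ (v.2 = y₀ ∨ ∃ c ∈ botCluster x₀ x₁ y₀ y₁ ω, Adj c v)}

theorem botCluster_subset_rect : botCluster x₀ x₁ y₀ y₁ ω ⊆ rect x₀ x₁ y₀ y₁ :=
  fun _ ⟨_, _, h⟩ => h.right_mem.1

theorem botCluster_subset_cld : botCluster x₀ x₁ y₀ y₁ ω ⊆ cld ω :=
  fun _ ⟨_, _, h⟩ => h.right_mem.2

theorem botCluster_conn {v : Site} (h : v ∈ botCluster x₀ x₁ y₀ y₁ ω) :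
    ∃ b : Site, b.2 = y₀ ∧ Conn (botCluster x₀ x₁ y₀ y₁ ω) b v := by
  obtain ⟨b, hb, hbv⟩ := h
  exact ⟨b, hb, hbv.cluster.mono fun w hw => ⟨b, hb, hw⟩⟩

theorem mem_botCluster_of_adj {c v : Site} (hc : c ∈ botCluster x₀ x₁ y₀ y₁ ω)
    (h : v ∈ rect x₀ x₁ y₀ y₁) (h1 : Adj c v) (h2 : v ∈ cld ω) :
    v ∈ botCluster x₀ x₁ y₀ y₁ ω := by
  obtain ⟨t, ht, htc⟩ := hc
  exact ⟨t, ht, htc.tail h1 ⟨h, h2⟩⟩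

theorem not_mem_opn_of_cld {v : Site} (h : v ∈ cld ω) : v ∉ opn ω := not_mem_opn.2 h

/-- An open crossing passes above the closed clusters of the bottom side. -/
theorem exists_above {Q : Set Site} {u u' v w : Site} (hQ : Q ⊆ rect x₀ x₁ y₀ y₁ ∩ opn ω)
    (hu : u.1 = x₀) (hu' : u'.1 = x₁) (huu' : Conn Q u u')
    (hv : v ∈ rect x₀ x₁ y₀ y₁) (hbot : v ∈ botCluster x₀ x₁ y₀ y₁ ω ∨ v.2 = y₀ ∨
      ∃ c ∈ botCluster x₀ x₁ y₀ y₁ ω, Adj c v)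
    (hw : w = v ∨ Adj v w ∧ w ∈ rect x₀ x₁ y₀ y₁) :
    v ∈ Q ∨ ∃ s ∈ Q, s.1 = w.1 ∧ w.2 ≤ s.2 := by
  set C := botCluster x₀ x₁ y₀ y₁ ω with hC
  set B : Set Site := C ∪ ({v} ∪ (rect x₀ x₁ y₀ y₁ ∩ {s | s.1 = w.1 ∧ w.2 ≤ s.2}))
  have hBR : B ⊆ rect x₀ x₁ y₀ y₁ := by
    rintro z (hz | rfl | hz)
    · exact botCluster_subset_rect hz
    · exact hv
    · exact hz.1
  have hvB : v ∈ B := by simp [B]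
  have h1 : ∃ b : Site, b.2 = y₀ ∧ Conn B b v := by
    rcases hbot with h | h | ⟨c, hc, hcv⟩
    · obtain ⟨b, hb, h⟩ := botCluster_conn h
      exact ⟨b, hb, h.mono Set.subset_union_left⟩
    · exact ⟨v, h, .refl hvB⟩
    · obtain ⟨b, hb, h⟩ := botCluster_conn hc
      exact ⟨b, hb, (h.mono Set.subset_union_left).tail hcv hvB⟩
  obtain ⟨b, hb, hbv⟩ := h1
  have hwR : w ∈ rect x₀ x₁ y₀ y₁ := by
    rcases hw with rfl | hw
    · exact hv
    · exact hw.2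
  have hwB : w ∈ B := Or.inr (Or.inr ⟨hwR, rfl, le_rfl⟩)
  have hvw : Conn B v w := by
    rcases hw with rfl | hw
    · exact .refl hvB
    · exact (Conn.refl hvB).tail hw.1 hwB
  rw [mem_rect] at hwR
  have hup : Conn B (w.1, w.2) (w.1, y₁) := by
    refine conn_vline (by omega) fun t h1 h2 => Or.inr (Or.inr ⟨?_, rfl, h1⟩)
    rw [mem_rect]; dsimp only; omega
  obtain ⟨z, hzQ, hzB⟩ := cross_meet (hQ.trans Set.inter_subset_left) hBR huu' hu hu'
    ((hbv.trans hvw).trans hup) hb rfl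
  rcases hzB with hz | rfl | hz
  · exact absurd (hQ hzQ).2 (not_mem_opn_of_cld (botCluster_subset_cld hz))
  · exact Or.inl hzQ
  · exact Or.inr ⟨z, hzQ, hz.2⟩

theorem exists_crossing_front (hx : x₀ ≤ x₁) (hy : y₀ ≤ y₁) {u u' : Site} (hu : u.1 = x₀)
    (hu' : u'.1 = x₁) (h : Conn (rect x₀ x₁ y₀ y₁ ∩ opn ω) u u') :
    ∃ w w' : Site, w.1 = x₀ ∧ w'.1 = x₁ ∧ Conn (front x₀ x₁ y₀ y₁ ω) w w' := by
  rcases hex hx hy (front x₀ x₁ y₀ y₁ ω) with ⟨w, w', hw, hw', hc⟩ | ⟨b, t, hb, ht, hbt⟩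
  · exact ⟨w, w', hw, hw', hc.mono Set.inter_subset_left⟩
  · exfalso
    have hR : ∀ v ∈ (front x₀ x₁ y₀ y₁ ω)ᶜ ∩ rect x₀ x₁ y₀ y₁,
        (v.2 = y₀ ∨ ∃ c ∈ botCluster x₀ x₁ y₀ y₁ ω, Adj c v) → v ∈ cld ω :=
      fun v hv hv' => not_mem_opn.1 fun h' => hv.1 ⟨hv.2, h', hv'⟩
    have htC : t ∈ botCluster x₀ x₁ y₀ y₁ ω := by
      clear ht
      induction hbt using Conn.tail_induction with
      | base h0 => exact ⟨b, hb, .refl ⟨h0.2, hR b h0 (Or.inl hb)⟩⟩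
      | step c d _ hcd hd ih =>
        exact mem_botCluster_of_adj ih hd.2 hcd (hR d hd (Or.inr ⟨c, ih, hcd⟩))
    obtain ⟨b', hb', hbt'⟩ := botCluster_conn htC
    obtain ⟨z, hz, hz'⟩ := cross_meet Set.inter_subset_left botCluster_subset_rect h hu hu' hbt'
      hb' ht
    exact not_mem_opn_of_cld (botCluster_subset_cld hz') hz.2

theorem HorizCrossing.subset {p : List Site} (h : HorizCrossing x₀ x₁ y₀ y₁ ω p) :
    {w | w ∈ p} ⊆ rect x₀ x₁ y₀ y₁ ∩ opn ω := fun w hw => ⟨h.1.2 w hw, h.2.1 w hw⟩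

/-- A crossing by sites next to the closed clusters of the bottom side is the lowest one. -/
theorem isLowestCrossing_of_front {p : List Site} (hp : HorizCrossing x₀ x₁ y₀ y₁ ω p)
    (hF : ∀ v ∈ p, v ∈ front x₀ x₁ y₀ y₁ ω) : IsLowestCrossing x₀ x₁ y₀ y₁ ω p := by
  refine ⟨hp, fun q hq v hv => ⟨hp.1.2 v hv, ?_⟩⟩
  by_cases hvq : v ∈ q
  · exact Or.inl hvq
  right
  rintro ⟨r, hr, hrv, ⟨t, ht, hrt⟩⟩
  have hvt : Conn (rect x₀ x₁ y₀ y₁ \ {w | w ∈ q}) v t :=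
    (hr.1.conn (List.mem_of_mem_head? hrv) (List.mem_of_mem_getLast? hrt)).mono hr.2
  obtain ⟨u, u', hu, hu', huu'⟩ := hq.conn
  have hCq : botCluster x₀ x₁ y₀ y₁ ω ⊆ rect x₀ x₁ y₀ y₁ \ {w | w ∈ q} := fun z hz =>
    ⟨botCluster_subset_rect hz, fun h =>
      not_mem_opn_of_cld (botCluster_subset_cld hz) (hq.2.1 z h)⟩
  have hbv : ∃ b : Site, b.2 = y₀ ∧ Conn (rect x₀ x₁ y₀ y₁ \ {w | w ∈ q}) b v := by
    rcases (hF v hv).2.2 with h | ⟨c, hc, hcv⟩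
    · exact ⟨v, h, .refl hvt.left_mem⟩
    · obtain ⟨b, hb, hbc⟩ := botCluster_conn hc
      exact ⟨b, hb, (hbc.mono hCq).tail hcv hvt.left_mem⟩
  obtain ⟨b, hb, hbv⟩ := hbv
  obtain ⟨z, hz, hz'⟩ := cross_meet (hq.subset.trans Set.inter_subset_left) Set.sdiff_subset
    huu' hu hu' (hbv.trans hvt) hb ht.2
  exact hz'.2 hz

theorem IsLowestCrossing.exists_above {p q : List Site} (hp : IsLowestCrossing x₀ x₁ y₀ y₁ ω p)
    (hq : HorizCrossing x₀ x₁ y₀ y₁ ω q) {v : Site} (hv : v ∈ p) :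
    ∃ s ∈ q, s.1 = v.1 ∧ v.2 ≤ s.2 := by
  obtain ⟨hvR, h | h⟩ := hp.2 q hq v hv
  · exact ⟨v, h, rfl, le_rfl⟩
  by_contra! hcon
  have hvR' := mem_rect.1 hvR
  have hup : Conn (rect x₀ x₁ y₀ y₁ \ {w | w ∈ q}) (v.1, v.2) (v.1, y₁) := by
    refine conn_vline (by omega) fun t h1 h2 => ⟨?_, fun hq => ?_⟩
    · rw [mem_rect]; dsimp only; omega
    · exact absurd (hcon _ hq rfl) (not_lt.2 h1)
  obtain ⟨r, hr, hr1, hr2⟩ := hup.exists_path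
  exact h ⟨r, hr, hr1, _, ⟨hup.right_mem.1, rfl⟩, hr2⟩

theorem exists_lowestCrossing (hx : x₀ ≤ x₁) (hy : y₀ ≤ y₁) {u u' : Site} (hu : u.1 = x₀)
    (hu' : u'.1 = x₁) (h : Conn (rect x₀ x₁ y₀ y₁ ∩ opn ω) u u') :
    ∃ p, IsLowestCrossing x₀ x₁ y₀ y₁ ω p := by
  obtain ⟨w, w', hw, hw', hc⟩ := exists_crossing_front hx hy hu hu' h
  obtain ⟨p, hp, hpF⟩ := exists_horizCrossing (fun v hv => hv.1) (fun v hv => hv.2.1) hc hw hw'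
  exact ⟨p, isLowestCrossing_of_front hp hpF⟩

theorem HighestPair.eq {p q : List Site} {y z : Site} (hp : IsLowestCrossing x₀ x₁ y₀ y₁ ω p)
    (hq : IsLowestCrossing x₀ x₁ y₀ y₁ ω q) (hy : HighestPair p y) (hz : HighestPair q z) :
    y = z := by
  obtain ⟨s, hs, hs1, hs2⟩ := hp.exists_above hq.1 hy.1
  obtain ⟨t, ht, ht1, ht2⟩ := hp.exists_above hq.1 hy.2.1
  obtain ⟨r, hr, hr1, hr2⟩ := hq.exists_above hp.1 hz.1
  have hs3 := hz.2.2 s hs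
  have ht3 := hz.2.2 t ht
  have hr3 := hy.2.2 r hr
  simp only [Prod.ext_iff] at *
  omega

/-- A criterion for the position of the highest sites of the lowest crossing. -/
theorem exists_lowestCrossing_highestPair {x h : ℤ} {u u' : Site} (hu : u.1 = x₀)
    (hu' : u'.1 = x₁)
    (hc : Conn (rect x₀ x₁ y₀ y₁ ∩ opn ω ∩ ({v | v.2 ≤ h} ∪ {(x - 1, h + 1), (x, h + 1)})) u u')
    (hbot : (x, h) ∈ botCluster x₀ x₁ y₀ y₁ ω) (h1 : (x - 1, h + 1) ∈ rect x₀ x₁ y₀ y₁)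
    (h2 : (x, h + 1) ∈ rect x₀ x₁ y₀ y₁) :
    ∃ p, IsLowestCrossing x₀ x₁ y₀ y₁ ω p ∧ HighestPair p (x - 1, h + 1) := by
  have hR := mem_rect.1 h1
  obtain ⟨p, hp⟩ := exists_lowestCrossing (ω := ω) (x₀ := x₀) (x₁ := x₁) (y₀ := y₀) (y₁ := y₁)
    (by omega) (by omega) hu hu' (hc.mono Set.inter_subset_left)
  obtain ⟨q, hq, hqs⟩ := exists_horizCrossing (x₀ := x₀) (x₁ := x₁) (y₀ := y₀) (y₁ := y₁) (ω := ω)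
    (fun v hv => hv.1.1) (fun v hv => hv.1.2) hc hu hu'
  have hle : ∀ w ∈ p, w.2 ≤ h + 1 ∧ (w.2 = h + 1 → w = (x - 1, h + 1) ∨ w = (x, h + 1)) := by
    intro w hw
    obtain ⟨s, hs, hs1, hs2⟩ := hp.exists_above hq hw
    rcases (hqs s hs).2 with h | h
    · have h : s.2 ≤ _ := h
      omega
    · simp only [Set.mem_insert_iff, Set.mem_singleton_iff, Prod.ext_iff] at *
      omega
  have hmem : ∀ x', (x', h + 1) ∈ rect x₀ x₁ y₀ y₁ → Adj (x, h) (x', h + 1) → (x', h + 1) ∈ p := by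
    intro x' hx' hadj
    obtain ⟨w, w', hw, hw', hww'⟩ := hp.1.conn
    rcases _root_.exists_above hp.1.subset hw hw' hww' (botCluster_subset_rect hbot) (Or.inl hbot)
      (Or.inr ⟨hadj, hx'⟩) with h | ⟨s, hs, hs1, hs2⟩
    · exact absurd (hp.1.2.1 _ h) (not_mem_opn_of_cld (botCluster_subset_cld hbot))
    · have h3 := (hle s hs).1
      dsimp only at hs1 hs2
      have : s = (x', h + 1) := Prod.ext hs1 (by dsimp only; omega)
      rw [← this]
      exact hs
  refine ⟨p, hp, hmem _ h1 (by rw [adj_iff]; dsimp only; omega), ?_, ?_⟩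
  · have := hmem _ h2 (by rw [adj_iff]; dsimp only; omega)
    simpa using this
  · intro w hw
    have := hle w hw
    simpa using this

end Lowest

/-! ### Creating a peak by a local modification -/

/-- The square `B(n)` as a set of sites. -/
def ball (n : ℤ) : Set Site := rect (-n) n (-n) n

theorem mem_ball {n : ℤ} {v : Site} : v ∈ ball n ↔ -n ≤ v.1 ∧ v.1 ≤ n ∧ -n ≤ v.2 ∧ v.2 ≤ n :=
  Iff.rfl

/-- The lowest crossing of `B(n)` has its highest sites at `y` and `y + (1, 0)`. -/
def PairAt (n : ℤ) (ω : Config) (y : Site) : Prop :=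
  2 * |y.1| ≤ n ∧ 2 * |y.2| ≤ n ∧ ∃ p, IsLowestCrossing (-n) n (-n) n ω p ∧ HighestPair p y

/-- A site next to the closed clusters of the bottom side and as high as some crossing. -/
def IsPeak (n : ℤ) (ω : Config) (v : Site) : Prop :=
  2 * (|v.1| + 1) ≤ n ∧ 0 ≤ v.2 ∧ 2 * (v.2 + 1) ≤ n ∧
    (∃ u u' : Site, u.1 = -n ∧ u'.1 = n ∧ Conn (ball n ∩ opn ω ∩ {w | w.2 ≤ v.2}) u u') ∧
    ∃ c ∈ botCluster (-n) n (-n) n ω, Adj c v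

/-- A site and four of its neighbors. -/
def spot (v : Site) : Fin 5 → Site :=
  ![v, (v.1 - 1, v.2), (v.1 - 1, v.2 + 1), (v.1, v.2 + 1), (v.1 + 1, v.2)]

theorem mem_range_spot {v w : Site} : w ∈ Set.range (spot v) ↔
    w = v ∨ w = (v.1 - 1, v.2) ∨ w = (v.1 - 1, v.2 + 1) ∨ w = (v.1, v.2 + 1) ∨
      w = (v.1 + 1, v.2) := by
  simp only [spot, Set.mem_range, Fin.exists_fin_succ, eq_comm]
  simp [eq_comm]

open Classical in
/-- Close the site `v` and open four of its neighbors. -/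
noncomputable def raise (v : Site) (ω : Config) : Config :=
  fun w => if w = v then false else if w ∈ Set.range (spot v) then true else ω w

theorem raise_self (v : Site) (ω : Config) : raise v ω v = false := if_pos rfl

theorem raise_of_mem {v w : Site} {ω : Config} (h : w ≠ v) (h' : w ∈ Set.range (spot v)) :
    raise v ω w = true := by
  rw [raise, if_neg h, if_pos h']

theorem raise_of_not_mem {v w : Site} {ω : Config} (h : w ∉ Set.range (spot v)) :
    raise v ω w = ω w := by
  have : w ≠ v := fun h' => h (mem_range_spot.2 (Or.inl h'))
  rw [raise, if_neg this, if_neg h]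

theorem spot_mem_ball {n : ℤ} {v w : Site} (h1 : 2 * (|v.1| + 1) ≤ n) (h2 : 0 ≤ v.2)
    (h3 : 2 * (v.2 + 1) ≤ n) (hw : w ∈ Set.range (spot v)) : w ∈ ball n := by
  have h4 := abs_le.1 (le_refl |v.1|)
  rw [mem_range_spot] at hw
  simp only [Prod.ext_iff] at hw
  rw [mem_ball]
  omega

theorem Adj.of_le {v w : Site} (h : Adj v w) (hw : w.2 ≤ v.2) : w = (v.1 + 1, v.2) ∨
    w = (v.1 - 1, v.2) ∨ Adj w (v.1 - 1, v.2) ∨ Adj w (v.1 + 1, v.2) := by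
  rw [adj_iff] at h
  rcases h with h | h | h | h | h | h
  · exact Or.inl (Prod.ext h.1 h.2)
  · exact Or.inr (Or.inl (Prod.ext h.1 h.2))
  · omega
  · refine Or.inr (Or.inr (Or.inl ?_))
    rw [adj_iff]
    dsimp only
    omega
  · refine Or.inr (Or.inr (Or.inr ?_))
    rw [adj_iff]
    dsimp only
    omega
  · omega

theorem IsPeak.pairAt {n : ℤ} {ω : Config} {v : Site} (h : IsPeak n ω v) :
    PairAt n (raise v ω) (v.1 - 1, v.2 + 1) := by
  obtain ⟨h1, h2, h3, ⟨u, u', hu, hu', hc⟩, ⟨c, hcC, hcv⟩⟩ := h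
  have hspot {w : Site} (hw : w ∈ Set.range (spot v)) := spot_mem_ball h1 h2 h3 hw
  have hv := abs_le.1 (le_refl |v.1|)
  refine ⟨?_, ?_, ?_⟩
  · dsimp only
    have : |v.1 - 1| ≤ |v.1| + 1 := abs_le.2 (by omega)
    omega
  · dsimp only
    rw [abs_of_nonneg (by omega)]
    omega
  have hlow : ∀ z ∈ botCluster (-n) n (-n) n ω, z.2 < v.2 := by
    intro z hz
    rcases exists_above (Q := ball n ∩ opn ω ∩ {w | w.2 ≤ v.2}) Set.inter_subset_left hu hu' hc
      (botCluster_subset_rect hz) (Or.inl hz) (Or.inl rfl) with h | ⟨s, hs, hs1, hs2⟩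
    · exact absurd h.1.2 (not_mem_opn_of_cld (botCluster_subset_cld hz))
    · have h4 : s.2 ≤ v.2 := hs.2
      refine lt_of_le_of_ne (hs2.trans h4) fun h5 => ?_
      have : s = z := Prod.ext hs1 (by omega)
      exact absurd hs.1.2
        (this ▸ not_mem_opn_of_cld (botCluster_subset_cld hz))
  have hvC : v ∈ botCluster (-n) n (-n) n (raise v ω) := by
    have hmono : botCluster (-n) n (-n) n ω ⊆ botCluster (-n) n (-n) n (raise v ω) := by
      intro z hz
      obtain ⟨b, hb, hbz⟩ := botCluster_conn hz
      refine ⟨b, hb, hbz.mono fun w hw => ⟨botCluster_subset_rect hw, ?_⟩⟩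
      have := hlow w hw
      rw [mem_cld, raise_of_not_mem]
      · exact botCluster_subset_cld hw
      · rw [mem_range_spot]
        simp only [Prod.ext_iff]
        omega
    exact mem_botCluster_of_adj (hmono hcC) (hspot (mem_range_spot.2 (Or.inl rfl))) hcv
      (raise_self v ω)
  set L' : Set Site := rect (-n) n (-n) n ∩ opn (raise v ω) ∩
    ({w | w.2 ≤ v.2} ∪ {(v.1 - 1, v.2 + 1), (v.1, v.2 + 1)}) with hL'
  have hnb : ∀ w, w ≠ v → w ∈ Set.range (spot v) → w ∈ L' := by
    intro w hw hw'
    refine ⟨⟨hspot hw', raise_of_mem hw hw'⟩, ?_⟩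
    rcases mem_range_spot.1 hw' with rfl | rfl | rfl | rfl | rfl <;> simp
  have hd1 : (v.1 - 1, v.2) ∈ L' :=
    hnb _ (fun h => by have := congrArg Prod.fst h; dsimp only at this; omega)
      (mem_range_spot.2 (by simp))
  have hd2 : (v.1 - 1, v.2 + 1) ∈ L' :=
    hnb _ (fun h => by have := congrArg Prod.fst h; dsimp only at this; omega)
      (mem_range_spot.2 (by simp))
  have hd3 : (v.1, v.2 + 1) ∈ L' :=
    hnb _ (fun h => by have := congrArg Prod.snd h; dsimp only at this; omega)
      (mem_range_spot.2 (by simp))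
  have hd4 : (v.1 + 1, v.2) ∈ L' :=
    hnb _ (fun h => by have := congrArg Prod.fst h; dsimp only at this; omega)
      (mem_range_spot.2 (by simp))
  have hd : Conn L' (v.1 + 1, v.2) (v.1 - 1, v.2) :=
    (((Conn.refl hd4).tail (by rw [adj_iff]; simp) hd3).tail (by rw [adj_iff]; simp) hd2).tail
      (by rw [adj_iff]; simp) hd1
  have hLL : ∀ w ∈ ball n ∩ opn ω ∩ {w | w.2 ≤ v.2}, w ≠ v → w ∈ L' := by
    intro w hw hwv
    by_cases hw' : w ∈ Set.range (spot v)
    · exact hnb w hwv hw'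
    · refine ⟨⟨hw.1.1, ?_⟩, Or.inl hw.2⟩
      rw [mem_opn, raise_of_not_mem hw']
      exact hw.1.2
  have hadj : ∀ w ∈ ball n ∩ opn ω ∩ {w | w.2 ≤ v.2}, w ≠ v → Adj v w →
      Conn L' w (v.1 - 1, v.2) := by
    intro w hw hwv hvw
    have hwL := hLL w hw hwv
    rcases hvw.of_le hw.2 with rfl | rfl | h | h
    · exact hd
    · exact .refl hd1
    · exact (Conn.refl hwL).tail h hd1
    · exact .head hwL h hd
  have hne : ∀ z : Site, z.1 = -n ∨ z.1 = n → z ≠ v := by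
    rintro z hz rfl
    omega
  have key : (u' ≠ v → Conn L' u u') ∧ (u' = v → Conn L' u (v.1 - 1, v.2)) := by
    clear hu'
    induction hc using Conn.tail_induction with
    | base h0 => exact ⟨fun h => .refl (hLL u h0 h), fun h => absurd h (hne u (Or.inl hu))⟩
    | step a b ha hab hb ih =>
      constructor
      · intro hbv
        by_cases hav : a = v
        · exact (ih.2 hav).trans (hadj b hb hbv (hav ▸ hab)).symm
        · exact (ih.1 hav).tail hab (hLL b hb hbv)
      · intro hbv
        by_cases hav : a = v
        · exact ih.2 hav
        · exact (ih.1 hav).trans (hadj a ha.right_mem hav (hbv ▸ hab.symm))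
  exact exists_lowestCrossing_highestPair (x := v.1) (h := v.2) hu hu'
    (key.1 (hne u' (Or.inr hu'))) hvC (hspot (mem_range_spot.2 (by simp)))
    (hspot (mem_range_spot.2 (by simp)))

theorem PairAt.eq {n : ℤ} {ω : Config} {y z : Site} (hy : PairAt n ω y) (hz : PairAt n ω z) :
    y = z := by
  obtain ⟨-, -, p, hp, hpy⟩ := hy
  obtain ⟨-, -, q, hq, hqz⟩ := hz
  exact HighestPair.eq hp hq hpy hqz

theorem horizCrossing_congr {x₀ x₁ y₀ y₁ : ℤ} {ω ω' : Config} {p : List Site}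
    (h : ∀ v ∈ rect x₀ x₁ y₀ y₁, ω v = ω' v) (hp : HorizCrossing x₀ x₁ y₀ y₁ ω p) :
    HorizCrossing x₀ x₁ y₀ y₁ ω' p :=
  ⟨hp.1, fun v hv => (h v (hp.1.2 v hv)).symm.trans (hp.2.1 v hv), hp.2.2⟩

theorem local_pairAt (n : ℤ) : Local (boxF (-n) n (-n) n) {ω | ∃ y, PairAt n ω y} := by
  rintro ω ω' h ⟨y, h1, h2, p, hp, hpy⟩
  have h' : ∀ v ∈ rect (-n) n (-n) n, ω v = ω' v := fun v hv => h v (rect_subset_boxF _ _ _ _ hv)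
  exact ⟨y, h1, h2, p, ⟨horizCrossing_congr h' hp.1, fun q hq =>
    hp.2 q (horizCrossing_congr (fun v hv => (h' v hv).symm) hq)⟩, hpy⟩

theorem local_isPeak (n : ℤ) : Local (boxF (-n) n (-n) n) {ω | ∃ v, IsPeak n ω v} := by
  rintro ω ω' h ⟨v, h1, h2, h3, ⟨u, u', hu, hu', hc⟩, ⟨c, ⟨b, hb, hbc⟩, hcv⟩⟩
  have h' : ∀ v ∈ rect (-n) n (-n) n, ω v = ω' v := fun v hv => h v (rect_subset_boxF _ _ _ _ hv)
  refine ⟨v, h1, h2, h3, ⟨u, u', hu, hu', hc.mono fun w hw => ⟨⟨hw.1.1, ?_⟩, hw.2⟩⟩,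
    ⟨c, ⟨b, hb, hbc.mono fun w hw => ⟨hw.1, ?_⟩⟩, hcv⟩⟩
  · exact (h' w hw.1.1).symm.trans hw.1.2
  · exact (h' w hw.1).symm.trans hw.2

theorem IsBernoulliHalf.measure_isPeak_le {μ : Measure Config} (hμ : IsBernoulliHalf μ) (n : ℤ) :
    μ {ω | ∃ v, IsPeak n ω v} ≤ 32 * μ {ω | ∃ y, PairAt n ω y} := by
  classical
  let peak : Config → Site := fun ω => Classical.epsilon (IsPeak n ω)
  have hpeak : ∀ ω ∈ {ω | ∃ v, IsPeak n ω v}, IsPeak n ω (peak ω) :=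
    fun ω hω => Classical.epsilon_spec hω
  have key := hμ.measure_le_of_injOn (local_pairAt n) (local_isPeak n)
    (fun ω => raise (peak ω) ω) (fun ω i => ω (spot (peak ω) i))
    (fun ω hω => ⟨_, (hpeak ω hω).pairAt⟩) (by
      intro ω hω ω' hω' hoff hon ht w hw
      have h1 := hpeak ω hω
      have h2 := hpeak ω' hω'
      have hball : ∀ {ω : Config} {z : Site}, IsPeak n ω (peak ω) →
          z ∉ boxF (-n) n (-n) n → z ∉ Set.range (spot (peak ω)) := fun h hz hz' =>
        hz (rect_subset_boxF _ _ _ _ (spot_mem_ball h.1 h.2.1 h.2.2.1 hz'))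
      have heq : raise (peak ω) ω = raise (peak ω') ω' := by
        ext z
        by_cases hz : z ∈ boxF (-n) n (-n) n
        · exact hon z hz
        · rw [raise_of_not_mem (hball h1 hz), raise_of_not_mem (hball h2 hz), hoff z hz]
      have hpp : peak ω = peak ω' := by
        have h3 := h1.pairAt.eq (heq ▸ h2.pairAt)
        rw [Prod.ext_iff] at h3 ⊢
        dsimp only at h3
        omega
      by_cases hw' : w ∈ Set.range (spot (peak ω))
      · obtain ⟨i, rfl⟩ := hw'
        have := congrFun ht i
        rwa [← hpp] at this
      · calc ω w = raise (peak ω) ω w := (raise_of_not_mem hw').symm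
          _ = raise (peak ω') ω' w := congrFun heq w
          _ = ω' w := raise_of_not_mem (hpp ▸ hw'))
  simpa using key

/-! ### Producing a peak -/

theorem Conn.meet {x₀ x₁ y₀ y₁ : ℤ} {A B : Set Site} {u v w z : Site}
    (hA : A ⊆ rect x₀ x₁ y₀ y₁) (hB : B ⊆ rect x₀ x₁ y₀ y₁) (huv : Conn A u v) (hu : u.1 = x₀)
    (hv : v.1 = x₁) (hwz : Conn B w z) (hw : w.2 = y₀) (hz : z.2 = y₁) :
    ∃ r, Conn A u r ∧ Conn B w r :=
  cross_meet (Conn.cluster_subset.trans hA) (Conn.cluster_subset.trans hB) huv.cluster hu hv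
    hwz.cluster hw hz

theorem rect_subset_rect {x₀ x₁ y₀ y₁ x₀' x₁' y₀' y₁' : ℤ} (h1 : x₀' ≤ x₀) (h2 : x₁ ≤ x₁')
    (h3 : y₀' ≤ y₀) (h4 : y₁ ≤ y₁') : rect x₀ x₁ y₀ y₁ ⊆ rect x₀' x₁' y₀' y₁' := by
  intro v hv
  rw [mem_rect] at *
  omega

/-- Five crossings that together form an arch. -/
def arch (n K : ℤ) : Set Config :=
  HC (-n) (-(2 * K)) (-(4 * K)) (-(2 * K)) ∩ HC (2 * K) n (-(4 * K)) (-(2 * K)) ∩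
    HC (-(4 * K)) (4 * K) (2 * K) (4 * K) ∩
    (VC (-(4 * K)) (-(2 * K)) (-(4 * K)) (4 * K) ∩ VC (2 * K) (4 * K) (-(4 * K)) (4 * K))

/-- A crossing of `B(n)` that is high only in the middle. -/
theorem exists_conn_of_arch {n K : ℤ} (hK : 1 ≤ K) (hn : 4 * K ≤ n) {ω : Config}
    (h : ω ∈ arch n K) : ∃ u u' : Site, u.1 = -n ∧ u'.1 = n ∧
      Conn (ball n ∩ {w | w.2 ≤ 4 * K ∧ (0 ≤ w.2 → |w.1| ≤ 4 * K) ∧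
        (2 * K ≤ |w.1| ∨ 2 * K ≤ w.2)} ∩ opn ω) u u' := by
  obtain ⟨⟨⟨⟨u, hu, a, ha, hua⟩, ⟨b, hb, u', hu', hbu⟩⟩, ⟨t, ht, t', ht', htt⟩⟩,
    ⟨⟨l, hl, l', hl', hll⟩, ⟨r, hr, r', hr', hrr⟩⟩⟩ := h
  have hsub {x₀ x₁ y₀ y₁ x₀' x₁' y₀' y₁' : ℤ} (h1 : x₀' ≤ x₀) (h2 : x₁ ≤ x₁') (h3 : y₀' ≤ y₀)
      (h4 : y₁ ≤ y₁') : rect x₀ x₁ y₀ y₁ ∩ opn ω ⊆ rect x₀' x₁' y₀' y₁' :=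
    Set.inter_subset_left.trans (rect_subset_rect h1 h2 h3 h4)
  obtain ⟨z₁, hz₁, hz₁'⟩ := Conn.meet (x₀ := -n) (x₁ := -(2 * K)) (y₀ := -(4 * K)) (y₁ := 4 * K)
    (hsub (by omega) (by omega) (by omega) (by omega))
    (hsub (by omega) (by omega) (by omega) (by omega)) hua hu ha hll hl hl'
  obtain ⟨z₂, hz₂, hz₂'⟩ := Conn.meet (x₀ := -(4 * K)) (x₁ := 4 * K) (y₀ := -(4 * K)) (y₁ := 4 * K)
    (hsub (by omega) (by omega) (by omega) (by omega))
    (hsub (by omega) (by omega) (by omega) (by omega)) htt ht ht' hll hl hl'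
  obtain ⟨z₃, hz₃, hz₃'⟩ := Conn.meet (x₀ := -(4 * K)) (x₁ := 4 * K) (y₀ := -(4 * K)) (y₁ := 4 * K)
    (hsub (by omega) (by omega) (by omega) (by omega))
    (hsub (by omega) (by omega) (by omega) (by omega)) htt ht ht' hrr hr hr'
  obtain ⟨z₄, hz₄, hz₄'⟩ := Conn.meet (x₀ := 2 * K) (x₁ := n) (y₀ := -(4 * K)) (y₁ := 4 * K)
    (hsub (by omega) (by omega) (by omega) (by omega))
    (hsub (by omega) (by omega) (by omega) (by omega)) hbu hb hu' hrr hr hr'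
  have hQ {x₀ x₁ y₀ y₁ : ℤ} (h1 : -n ≤ x₀) (h2 : x₁ ≤ n) (h3 : -n ≤ y₀) (h4 : y₁ ≤ 4 * K)
      (h5 : y₁ < 0 ∨ (-(4 * K) ≤ x₀ ∧ x₁ ≤ 4 * K))
      (h6 : x₁ ≤ -(2 * K) ∨ 2 * K ≤ x₀ ∨ 2 * K ≤ y₀) :
      rect x₀ x₁ y₀ y₁ ∩ opn ω ⊆ ball n ∩ {w | w.2 ≤ 4 * K ∧ (0 ≤ w.2 → |w.1| ≤ 4 * K) ∧
        (2 * K ≤ |w.1| ∨ 2 * K ≤ w.2)} ∩ opn ω := by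
    rintro w ⟨hw, hw'⟩
    rw [mem_rect] at hw
    refine ⟨⟨?_, ?_, ?_, ?_⟩, hw'⟩
    · rw [mem_ball]; omega
    · omega
    · intro h; rw [abs_le]; omega
    · rw [le_abs]; omega
  have hL := hQ (x₀ := -n) (x₁ := -(2 * K)) (y₀ := -(4 * K)) (y₁ := -(2 * K)) (by omega) (by omega)
    (by omega) (by omega) (by omega) (by omega)
  have hR := hQ (x₀ := 2 * K) (x₁ := n) (y₀ := -(4 * K)) (y₁ := -(2 * K)) (by omega) (by omega)
    (by omega) (by omega) (by omega) (by omega)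
  have hT := hQ (x₀ := -(4 * K)) (x₁ := 4 * K) (y₀ := 2 * K) (y₁ := 4 * K) (by omega) (by omega)
    (by omega) (by omega) (by omega) (by omega)
  have hV := hQ (x₀ := -(4 * K)) (x₁ := -(2 * K)) (y₀ := -(4 * K)) (y₁ := 4 * K) (by omega)
    (by omega) (by omega) (by omega) (by omega) (by omega)
  have hW := hQ (x₀ := 2 * K) (x₁ := 4 * K) (y₀ := -(4 * K)) (y₁ := 4 * K) (by omega)
    (by omega) (by omega) (by omega) (by omega) (by omega)
  refine ⟨u, u', hu, hu', ?_⟩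
  exact (hz₁.mono hL).trans <| (hz₁'.symm.mono hV).trans <| (hz₂'.mono hV).trans <|
    (hz₂.symm.mono hT).trans <| (hz₃.mono hT).trans <| (hz₃'.symm.mono hW).trans <|
    (hz₄'.mono hW).trans <| (hz₄.symm.mono hR).trans (hbu.mono hR)

theorem exists_isPeak {n K : ℤ} (hK : 1 ≤ K) (hn : 8 * K + 2 ≤ n) {ω : Config} {u u' c : Site}
    (hu : u.1 = -n) (hu' : u'.1 = n)
    (huu' : Conn (ball n ∩ {w | w.2 ≤ 4 * K ∧ (0 ≤ w.2 → |w.1| ≤ 4 * K)} ∩ opn ω) u u')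
    (hc : c ∈ botCluster (-n) n (-n) n ω) (hc0 : c.2 = 0) : ∃ v, IsPeak n ω v := by
  have hQ : ball n ∩ {w | w.2 ≤ 4 * K ∧ (0 ≤ w.2 → |w.1| ≤ 4 * K)} ∩ opn ω ⊆
      rect (-n) n (-n) n ∩ opn ω := fun w hw => ⟨hw.1.1, hw.2⟩
  obtain ⟨w, w', hw, hw', hww'⟩ := exists_crossing_front (by omega) (by omega) hu hu' (huu'.mono hQ)
  have hPF : {z | Conn (front (-n) n (-n) n ω) w z} ⊆ front (-n) n (-n) n ω := Conn.cluster_subset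
  have hfin : {z | Conn (front (-n) n (-n) n ω) w z}.Finite :=
    (boxF (-n) n (-n) n).finite_toSet.subset fun z hz => rect_subset_boxF _ _ _ _ (hPF hz).1
  obtain ⟨v, hv, hmax⟩ := Set.exists_max_image _ (fun z : Site => z.2) hfin ⟨w', hww'⟩
  have hv0 : 0 ≤ v.2 := by
    have hPR : {z | Conn (front (-n) n (-n) n ω) w z} ⊆ rect (-n) n (-n) n ∩ opn ω :=
      fun z hz => ⟨(hPF hz).1, (hPF hz).2.1⟩
    rcases exists_above hPR hw hw' hww'.cluster (botCluster_subset_rect hc) (Or.inl hc)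
      (Or.inl rfl) with h | ⟨s, hs, -, hs2⟩
    · exact hc0 ▸ hmax _ h
    · have := hmax s hs
      omega
  have hvF := hPF hv
  have hs : ∃ s ∈ ball n ∩ {w : Site | w.2 ≤ 4 * K ∧ (0 ≤ w.2 → |w.1| ≤ 4 * K)} ∩ opn ω,
      s.1 = v.1 ∧ v.2 ≤ s.2 := by
    rcases exists_above hQ hu hu' huu' hvF.1 (Or.inr hvF.2.2) (Or.inl rfl) with h | h
    · exact ⟨v, h, rfl, le_rfl⟩
    · exact h
  obtain ⟨s, ⟨⟨-, hs1, hs2⟩, -⟩, hs3, hs4⟩ := hs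
  have hs2 := hs2 (by omega)
  rw [hs3] at hs2
  refine ⟨v, by omega, hv0, by omega, ⟨w, w', hw, hw', hww'.cluster.mono fun z hz => ?_⟩,
    hvF.2.2.resolve_left (by omega)⟩
  exact ⟨⟨(hPF hz).1, (hPF hz).2.1⟩, hmax z hz⟩

theorem VC.incr {x₀ x₁ y₀ y₁ : ℤ} : Incr (VC x₀ x₁ y₀ y₁) := Link.incr

theorem HC.incr {x₀ x₁ y₀ y₁ : ℤ} : Incr (HC x₀ x₁ y₀ y₁) := Link.incr

theorem arch.incr {n K : ℤ} : Incr (arch n K) :=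
  ((HC.incr.inter HC.incr).inter HC.incr).inter (VC.incr.inter VC.incr)

theorem boxF_subset_boxF {x₀ x₁ y₀ y₁ x₀' x₁' y₀' y₁' : ℤ} (h1 : x₀' ≤ x₀) (h2 : x₁ ≤ x₁')
    (h3 : y₀' ≤ y₀) (h4 : y₁ ≤ y₁') : boxF x₀ x₁ y₀ y₁ ⊆ boxF x₀' x₁' y₀' y₁' :=
  Finset.product_subset_product (Finset.Icc_subset_Icc h1 h2) (Finset.Icc_subset_Icc h3 h4)

section Measure

variable {μ : Measure Config}

theorem IsBernoulliHalf.half_pow_le_inter (hμ : IsBernoulliHalf μ) {S : Finset Site}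
    {E F : Set Config} (hE : Local S E) (hF : Local S F) (hE' : Incr E) (hF' : Incr F) {i j : ℕ}
    (h : (1 / 2 : ℝ≥0∞) ^ i ≤ μ E) (h' : (1 / 2 : ℝ≥0∞) ^ j ≤ μ F) :
    (1 / 2 : ℝ≥0∞) ^ (i + j) ≤ μ (E ∩ F) := by
  rw [pow_add]
  exact (mul_le_mul' h h').trans (hμ.harris hE hF hE' hF')

theorem IsBernoulliHalf.half_pow_le_isPeak (hμ : IsBernoulliHalf μ) {n K : ℤ} (hK : 1 ≤ K)
    (h1 : 16 * K ≤ n) (h2 : n < 16 * K + 16) :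
    (1 / 2 : ℝ≥0∞) ^ 564 ≤ μ {ω | ∃ v, IsPeak n ω v} := by
  set S := boxF (-n) n (-n) n with hS
  have hH {x₀ x₁ y₀ : ℤ} (h1 : x₀ ≤ x₁) (h2 : x₁ - x₀ ≤ 32 * K) :
      (1 / 2 : ℝ≥0∞) ^ 94 ≤ μ (HC x₀ x₁ y₀ (y₀ + 2 * K)) :=
    (hμ.rsw (by omega) (by omega) h2).trans (hμ.hc_shift rfl (by ring))
  have hV {x₀ y₀ y₁ : ℤ} (h1 : y₀ ≤ y₁) (h2 : y₁ - y₀ ≤ 32 * K) :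
      (1 / 2 : ℝ≥0∞) ^ 94 ≤ μ (VC x₀ (x₀ + 2 * K) y₀ y₁) := (hH h1 h2).trans (hμ.vc_ge _ _ _ _)
  have hHl {x₀ x₁ y₀ y₁ : ℤ} (h1 : -n ≤ x₀) (h2 : x₁ ≤ n) (h3 : -n ≤ y₀) (h4 : y₁ ≤ n) :
      Local S (HC x₀ x₁ y₀ y₁) := (HC.isLocal _ _ _ _).mono (boxF_subset_boxF h1 h2 h3 h4)
  have hVl {x₀ x₁ y₀ y₁ : ℤ} (h1 : -n ≤ x₀) (h2 : x₁ ≤ n) (h3 : -n ≤ y₀) (h4 : y₁ ≤ n) :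
      Local S (VC x₀ x₁ y₀ y₁) := (VC.isLocal _ _ _ _).mono (boxF_subset_boxF h1 h2 h3 h4)
  have l₁ : Local S (HC (-n) (-(2 * K)) (-(4 * K)) (-(2 * K))) :=
    hHl (by omega) (by omega) (by omega) (by omega)
  have l₂ : Local S (HC (2 * K) n (-(4 * K)) (-(2 * K))) :=
    hHl (by omega) (by omega) (by omega) (by omega)
  have l₃ : Local S (HC (-(4 * K)) (4 * K) (2 * K) (4 * K)) :=
    hHl (by omega) (by omega) (by omega) (by omega)
  have l₄ : Local S (VC (-(4 * K)) (-(2 * K)) (-(4 * K)) (4 * K)) :=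
    hVl (by omega) (by omega) (by omega) (by omega)
  have l₅ : Local S (VC (2 * K) (4 * K) (-(4 * K)) (4 * K)) :=
    hVl (by omega) (by omega) (by omega) (by omega)
  have l₆ : Local S (VC (-K) K (-n) 0) := hVl (by omega) (by omega) (by omega) (by omega)
  have e₁ : (1 / 2 : ℝ≥0∞) ^ 94 ≤ μ (HC (-n) (-(2 * K)) (-(4 * K)) (-(2 * K))) := by
    convert hH (x₀ := -n) (x₁ := -(2 * K)) (y₀ := -(4 * K)) (by omega) (by omega) using 3
    ring
  have e₂ : (1 / 2 : ℝ≥0∞) ^ 94 ≤ μ (HC (2 * K) n (-(4 * K)) (-(2 * K))) := by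
    convert hH (x₀ := 2 * K) (x₁ := n) (y₀ := -(4 * K)) (by omega) (by omega) using 3
    ring
  have e₃ : (1 / 2 : ℝ≥0∞) ^ 94 ≤ μ (HC (-(4 * K)) (4 * K) (2 * K) (4 * K)) := by
    convert hH (x₀ := -(4 * K)) (x₁ := 4 * K) (y₀ := 2 * K) (by omega) (by omega) using 3
    ring
  have e₄ : (1 / 2 : ℝ≥0∞) ^ 94 ≤ μ (VC (-(4 * K)) (-(2 * K)) (-(4 * K)) (4 * K)) := by
    convert hV (x₀ := -(4 * K)) (y₀ := -(4 * K)) (y₁ := 4 * K) (by omega) (by omega) using 3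
    ring
  have e₅ : (1 / 2 : ℝ≥0∞) ^ 94 ≤ μ (VC (2 * K) (4 * K) (-(4 * K)) (4 * K)) := by
    convert hV (x₀ := 2 * K) (y₀ := -(4 * K)) (y₁ := 4 * K) (by omega) (by omega) using 3
    ring
  have e₆ : (1 / 2 : ℝ≥0∞) ^ 94 ≤ μ (VC (-K) K (-n) 0) := by
    convert hV (x₀ := -K) (y₀ := -n) (y₁ := 0) (by omega) (by omega) using 3
    ring
  have hlE : Local S (arch n K ∩ VC (-K) K (-n) 0) :=
    (((l₁.inter l₂).inter l₃).inter (l₄.inter l₅)).inter l₆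
  have hE : (1 / 2 : ℝ≥0∞) ^ 564 ≤ μ (arch n K ∩ VC (-K) K (-n) 0) :=
    hμ.half_pow_le_inter (((l₁.inter l₂).inter l₃).inter (l₄.inter l₅)) l₆ arch.incr VC.incr
      (hμ.half_pow_le_inter ((l₁.inter l₂).inter l₃) (l₄.inter l₅)
        ((HC.incr.inter HC.incr).inter HC.incr) (VC.incr.inter VC.incr)
        (hμ.half_pow_le_inter (l₁.inter l₂) l₃ (HC.incr.inter HC.incr) HC.incr
          (hμ.half_pow_le_inter l₁ l₂ HC.incr HC.incr e₁ e₂) e₃)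
        (hμ.half_pow_le_inter l₄ l₅ VC.incr VC.incr e₄ e₅)) e₆
  rw [← hμ.measure_recode (.refl Site) (fun w => decide (|w.1| ≤ K ∧ w.2 ≤ 0)) hlE] at hE
  refine hE.trans (measure_mono ?_)
  rintro ω ⟨harch, ⟨b, hb, t, ht, hbt⟩⟩
  obtain ⟨u, u', hu, hu', huu'⟩ := exists_conn_of_arch hK (by omega) harch
  refine exists_isPeak hK (by omega) hu hu' (huu'.mono ?_)
    ⟨b, hb, hbt.mono fun w hw => ⟨?_, ?_⟩⟩ ht
  · rintro w ⟨⟨hw1, hw2, hw3, hw4⟩, hw5⟩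
    refine ⟨⟨hw1, hw2, hw3⟩, ?_⟩
    have : ¬ (|w.1| ≤ K ∧ w.2 ≤ 0) := by omega
    have hw6 : xor (ω w) (decide (|w.1| ≤ K ∧ w.2 ≤ 0)) = true := hw5
    rwa [decide_eq_false this, Bool.xor_false] at hw6
  · have := mem_rect.1 hw.1
    rw [mem_rect]
    omega
  · have h3 := mem_rect.1 hw.1
    have h4 : |w.1| ≤ K ∧ w.2 ≤ 0 := ⟨abs_le.2 ⟨h3.1, h3.2.1⟩, h3.2.2.2⟩
    simpa [mem_opn, mem_cld, recode, h4] using hw.2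

/-- In small squares the lowest crossing has a peak with positive probability. -/
theorem IsBernoulliHalf.half_pow_le_pairAt (hμ : IsBernoulliHalf μ) {n : ℤ} (hn : 1 ≤ n) :
    (1 / 2 : ℝ≥0∞) ^ ((boxF (-n) n (-n) n).card) ≤ μ {ω | ∃ y, PairAt n ω y} := by
  have hcyl : μ (cyl _ _) = _ := hμ.2 (boxF (-n) n (-n) n) fun w =>
    decide ((w.2 = -1 ∧ w.1 ≠ 1) ∨ w = (0, 0) ∨ w = (1, 0))
  rw [← hcyl]
  refine measure_mono fun ω hω => ⟨(0, 0), by simp; omega, by simp; omega, ?_⟩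
  have hω' : ∀ w ∈ rect (-n) n (-n) n,
      ω w = decide ((w.2 = -1 ∧ w.1 ≠ 1) ∨ w = (0, 0) ∨ w = (1, 0)) :=
    fun w hw => hω w (rect_subset_boxF _ _ _ _ hw)
  set L : Set Site := rect (-n) n (-n) n ∩ opn ω ∩
    ({v | v.2 ≤ -1} ∪ {((1 : ℤ) - 1, (-1 : ℤ) + 1), (1, -1 + 1)}) with hL
  have hline : ∀ t, -n ≤ t → t ≤ n → t ≠ 1 → (t, -1) ∈ L := by
    intro t h1 h2 h3
    have hR : (t, -1) ∈ rect (-n) n (-n) n := by rw [mem_rect]; dsimp only; omega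
    refine ⟨⟨hR, ?_⟩, Or.inl (by simp)⟩
    rw [mem_opn, hω' _ hR]
    simp [h3]
  have h0R : ((0, 0) : Site) ∈ rect (-n) n (-n) n := by rw [mem_rect]; dsimp only; omega
  have h1R : ((1, 0) : Site) ∈ rect (-n) n (-n) n := by rw [mem_rect]; dsimp only; omega
  have h0L : ((0, 0) : Site) ∈ L := ⟨⟨h0R, by rw [mem_opn, hω' _ h0R]; simp⟩, by simp⟩
  have h1L : ((1, 0) : Site) ∈ L := ⟨⟨h1R, by rw [mem_opn, hω' _ h1R]; simp⟩, by simp⟩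
  have hc1 : Conn L (-n, -1) (0, -1) :=
    conn_hline (by omega) fun t h1 h2 => hline t h1 (by omega) (by omega)
  have hc2 : Conn L (-n, -1) (1, 0) :=
    (hc1.tail (by rw [adj_iff]; simp) h0L).tail (by rw [adj_iff]; simp) h1L
  have hc3 : ∃ u' : Site, u'.1 = n ∧ Conn L (-n, -1) u' := by
    by_cases hn1 : n = 1
    · exact ⟨_, hn1.symm, hc2⟩
    · have hc : Conn L (2, -1) (n, -1) :=
        conn_hline (by omega) fun t h1 h2 => hline t (by omega) h2 (by omega)
      exact ⟨_, rfl, (hc2.tail (by rw [adj_iff]; simp) hc.left_mem).trans hc⟩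
  obtain ⟨u', hu', hc4⟩ := hc3
  have hbot : Conn (rect (-n) n (-n) n ∩ cld ω) (1, -n) (1, -1) := by
    refine conn_vline (by omega) fun t h1 h2 => ?_
    have hR : (1, t) ∈ rect (-n) n (-n) n := by rw [mem_rect]; dsimp only; omega
    refine ⟨hR, ?_⟩
    rw [mem_cld, hω' _ hR]
    have : t ≠ 0 := by omega
    simp [this]
  exact exists_lowestCrossing_highestPair (x := 1) (h := -1) rfl hu' hc4 ⟨_, rfl, hbot⟩ h0R h1R

theorem IsBernoulliHalf.pairAt_ge (hμ : IsBernoulliHalf μ) {n : ℤ} (hn : 1 ≤ n) :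
    (1 / 2 : ℝ≥0∞) ^ 961 ≤ μ {ω | ∃ y, PairAt n ω y} := by
  have hanti {i j : ℕ} (h : i ≤ j) : (1 / 2 : ℝ≥0∞) ^ j ≤ (1 / 2) ^ i :=
    pow_le_pow_of_le_one zero_le (ENNReal.half_le_self) h
  by_cases h : n < 16
  · refine (hanti ?_).trans (hμ.half_pow_le_pairAt hn)
    have hcard : (boxF (-n) n (-n) n).card = (n + 1 + n).toNat * (n + 1 + n).toNat := by
      simp [boxF, Int.card_Icc]
    rw [hcard]
    calc (n + 1 + n).toNat * (n + 1 + n).toNat ≤ 31 * 31 := Nat.mul_le_mul (by omega) (by omega)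
      _ = 961 := by norm_num
  · have h1 := hμ.half_pow_le_isPeak (n := n) (K := n / 16) (by omega) (by omega) (by omega)
    refine (hanti (by norm_num)).trans (half_pow_le_of_pow_le (j := 564) (i := 5) ?_)
    exact (h1.trans (hμ.measure_isPeak_le n)).trans_eq (by norm_num)

end Measure

/-- There exists a constant `c > 0` such that for all integers `n ≥ 1`,
`P(U(n)) ≥ c`, where `U(n)` is the event that there is a site `y ∈ B(n/2)`
such that `y` and `y+(1,0)` are the unique pair of neighboring sites of
highest vertical level on a lowest horizontal open crossing of `B(n)`. -/
theorem statement15 :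
    ∃ c : ℝ≥0∞, 0 < c ∧
      ∀ μ : Measure Config, IsBernoulliHalf μ →
        ∀ n : ℕ, 1 ≤ n →
          c ≤ μ {ω | ∃ y : Site, 2 * |y.1| ≤ (n : ℤ) ∧ 2 * |y.2| ≤ (n : ℤ) ∧
              ∃ p, IsLowestCrossing (-(n : ℤ)) n (-(n : ℤ)) n ω p ∧
                HighestPair p y} := by
  refine ⟨(1 / 2) ^ 961, ENNReal.pow_pos (by simp) _, fun μ hμ n hn => ?_⟩
  exact hμ.pairAt_ge (by exact_mod_cast hn)
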